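/- (Strichartz-type estimate.) Let μ be a compactly supported finite Borel measure on ℝ^d satisfying |μ̂(ξ)| ≤ C|ξ|^{−a} for all ξ ≠ 0 with a > 1/2, and suppose that for some δ > 0 the dispersive estimate ‖P_j(μ_t ∗ μ̄_s)‖_{L^∞(ℝ^d)} ≤ C 2^{(d−2a)j} (1 + 2^j|t−s|)^{−δ} holds for all integers j ≥ 1 and all t, s ∈ I = [1,2]. Then there is a constant C' such that for all j ≥ 1 and all Schwartz functions f, ‖(P_j f) ∗ μ_t‖_{L^{2(δ+1)/δ}(ℝ^d × I)} ≤ C' 2^{j (d − δ − 2a(δ+1))/(2(δ+1))} ‖f‖_{L^2(ℝ^d)}, where the mixed norm is taken over (x,t) ∈ ℝ^d × I. -/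

import Mathlib

open MeasureTheory Real Set Metric FourierTransform
open scoped ENNReal NNReal RealInnerProductSpace

noncomputable section

variable {d : ℕ}

/-- Fourier transform of a finite Borel measure on ℝ^d:  μ̂(ξ) = ∫ e^{−2πi x·ξ} dμ(x). -/
def mFT (μ : Measure (EuclideanSpace ℝ (Fin d))) (ξ : EuclideanSpace ℝ (Fin d)) : ℂ :=
  ∫ x, Complex.exp (-(2 * (π : ℂ) * Complex.I * ((⟪x, ξ⟫ : ℝ) : ℂ))) ∂μ

/-- Convolution with the dilated measure: (f ∗ μ_t)(x) = ∫ f(x − t y) dμ(y). -/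
def convM (f : EuclideanSpace ℝ (Fin d) → ℂ) (μ : Measure (EuclideanSpace ℝ (Fin d)))
    (t : ℝ) (x : EuclideanSpace ℝ (Fin d)) : ℂ :=
  ∫ y, f (x - t • y) ∂μ

/-- Global maximal function M_μ f(x) = sup_{t>0} |(f ∗ μ_t)(x)|. -/
def Mmax (μ : Measure (EuclideanSpace ℝ (Fin d))) (f : EuclideanSpace ℝ (Fin d) → ℂ)
    (x : EuclideanSpace ℝ (Fin d)) : ℝ≥0∞ :=
  ⨆ t : {t : ℝ // 0 < t}, (‖convM f μ t x‖₊ : ℝ≥0∞)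

/-- Local maximal function M_μ^{loc} f(x) = sup_{t∈[1,2]} |(f ∗ μ_t)(x)|. -/
def MmaxLoc (μ : Measure (EuclideanSpace ℝ (Fin d))) (f : EuclideanSpace ℝ (Fin d) → ℂ)
    (x : EuclideanSpace ℝ (Fin d)) : ℝ≥0∞ :=
  ⨆ t : (Icc (1:ℝ) 2), (‖convM f μ t x‖₊ : ℝ≥0∞)

/-- L^p norm (in lintegral form) of an ℝ≥0∞-valued function on ℝ^d. -/
def lpE (g : EuclideanSpace ℝ (Fin d) → ℝ≥0∞) (p : ℝ) : ℝ≥0∞ :=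
  (∫⁻ x, g x ^ p) ^ (1 / p)

/-- Weak L^q quasinorm of an ℝ≥0∞-valued function on ℝ^d. -/
def wlpE (g : EuclideanSpace ℝ (Fin d) → ℝ≥0∞) (q : ℝ) : ℝ≥0∞ :=
  ⨆ l : ℝ≥0, (l : ℝ≥0∞) * (volume {x | (l : ℝ≥0∞) < g x}) ^ (1 / q)

/-- Lorentz L^{p,1} norm (up to a constant factor p) of a complex-valued function. -/
def lorentz1 (f : EuclideanSpace ℝ (Fin d) → ℂ) (p : ℝ) : ℝ≥0∞ :=
  ∫⁻ l in Ioi (0:ℝ), (volume {x | l < ‖f x‖}) ^ (1 / p)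

/-- Lorentz L^{p,r} quasinorm of a real-valued function,
‖f‖_{p,r} = ( ∫_0^∞ (λ · d_f(λ)^{1/p})^r dλ/λ )^{1/r}. -/
def lorentzR (f : EuclideanSpace ℝ (Fin d) → ℝ) (p r : ℝ) : ℝ≥0∞ :=
  (∫⁻ l in Ioi (0:ℝ),
      (ENNReal.ofReal l * (volume {x | l < |f x|}) ^ (1 / p)) ^ r / ENNReal.ofReal l) ^ (1 / r)

/-- Littlewood–Paley projection P_k for k ∈ ℤ: (P_k f)^(ξ) = β(2^{−k}|ξ|) f̂(ξ). -/
def Pproj (β : ℝ → ℝ) (k : ℤ) (f : EuclideanSpace ℝ (Fin d) → ℂ)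
    (x : EuclideanSpace ℝ (Fin d)) : ℂ :=
  ∫ ξ, Complex.exp (2 * (π : ℂ) * Complex.I * ((⟪x, ξ⟫ : ℝ) : ℂ)) *
    ((β ((2:ℝ) ^ (-k) * ‖ξ‖) : ℝ) : ℂ) * 𝓕 f ξ

/-- The multiplier operator T_j^t, with multiplier m_j(tξ) = μ̂(tξ) β(2^{−j}|tξ|). -/
def Tj (μ : Measure (EuclideanSpace ℝ (Fin d))) (β : ℝ → ℝ) (j : ℕ) (t : ℝ)
    (f : EuclideanSpace ℝ (Fin d) → ℂ) (x : EuclideanSpace ℝ (Fin d)) : ℂ :=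
  ∫ ξ, Complex.exp (2 * (π : ℂ) * Complex.I * ((⟪x, ξ⟫ : ℝ) : ℂ)) *
    (((β ((2:ℝ) ^ (-(j:ℤ)) * ‖t • ξ‖) : ℝ) : ℂ) * mFT μ (t • ξ)) * 𝓕 f ξ

/-- The maximal multiplier operator T_j^* f(x) = sup_{t>0} |T_j^t f(x)|. -/
def TjStar (μ : Measure (EuclideanSpace ℝ (Fin d))) (β : ℝ → ℝ) (j : ℕ)
    (f : EuclideanSpace ℝ (Fin d) → ℂ) (x : EuclideanSpace ℝ (Fin d)) : ℝ≥0∞ :=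
  ⨆ t : {t : ℝ // 0 < t}, (‖Tj μ β j t f x‖₊ : ℝ≥0∞)

/-- M_j f(x) = sup_{k∈ℤ} sup_{2^{−k} ≤ t < 2^{−k+1}} |(P_{k+j} f ∗ μ_t)(x)|. -/
def Mj (μ : Measure (EuclideanSpace ℝ (Fin d))) (β : ℝ → ℝ) (j : ℕ)
    (f : EuclideanSpace ℝ (Fin d) → ℂ) (x : EuclideanSpace ℝ (Fin d)) : ℝ≥0∞ :=
  ⨆ k : ℤ, ⨆ t : (Ico ((2:ℝ) ^ (-k)) ((2:ℝ) ^ (-k+1))),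
    (‖convM (Pproj β (k + j) f) μ t x‖₊ : ℝ≥0∞)

/-- P_j(μ_t ∗ μ̄_s)(x) = ∫ e^{2πi x·ξ} β(2^{−j}|ξ|) μ̂(tξ) conj(μ̂(sξ)) dξ. -/
def Kdisp (μ : Measure (EuclideanSpace ℝ (Fin d))) (β : ℝ → ℝ) (j : ℕ) (t s : ℝ)
    (x : EuclideanSpace ℝ (Fin d)) : ℂ :=
  ∫ ξ, Complex.exp (2 * (π : ℂ) * Complex.I * ((⟪x, ξ⟫ : ℝ) : ℂ)) *
    ((β ((2:ℝ) ^ (-(j:ℤ)) * ‖ξ‖) : ℝ) : ℂ) * (mFT μ (t • ξ) * (starRingEnd ℂ) (mFT μ (s • ξ)))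

/-- Convolution of a nonnegative function with a dilated measure, valued in [0,∞]. -/
def convNN (g : EuclideanSpace ℝ (Fin d) → ℝ) (σ : Measure (EuclideanSpace ℝ (Fin d)))
    (t : ℝ) (x : EuclideanSpace ℝ (Fin d)) : ℝ≥0∞ :=
  ∫⁻ y, ENNReal.ofReal (g (x - t • y)) ∂σ



/-- the off-diagonal majorant used in the HLS inequality -/
def hlsH (γ u r : ℝ) : ℝ :=
  if u * r ≤ 1 then u ^ (2 - γ) * r ^ (-γ) else u ^ (1 - γ / 2) * r ^ (-(1 + γ / 2))

lemma hls_aux (γ u v r : ℝ) (hγ : 0 < γ) (hγ1 : γ < 1) (hu : 0 ≤ u) (hv : 0 ≤ v) (hr : 0 < r)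
    (hvu : v ≤ u) (hvr : v * r ≤ 1) :
    u ^ (1 - γ / 2) * v ^ (1 - γ / 2) * r ^ (-γ) ≤ hlsH γ u r := by
  unfold hlsH
  split_ifs with h
  · have : u ^ (2 - γ) = u ^ (1 - γ / 2) * u ^ (1 - γ / 2) := by
      rw [← Real.rpow_add_of_nonneg hu (by linarith) (by linarith)]; congr 1; ring
    rw [this]
    have h1 : v ^ (1 - γ / 2) ≤ u ^ (1 - γ / 2) := Real.rpow_le_rpow hv hvu (by linarith)
    gcongr
  · have h1 : v ≤ r⁻¹ := by rw [← one_div, le_div_iff₀ hr]; exact hvr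
    have h2 : v ^ (1 - γ / 2) ≤ (r⁻¹) ^ (1 - γ / 2) := Real.rpow_le_rpow hv h1 (by linarith)
    have h3 : r ^ (-(1 + γ / 2)) = (r⁻¹) ^ (1 - γ / 2) * r ^ (-γ) := by
      rw [Real.inv_rpow hr.le, ← Real.rpow_neg hr.le, ← Real.rpow_add hr]; congr 1; ring
    rw [h3, mul_assoc]
    gcongr

lemma hlsH_nonneg (γ u r : ℝ) (hu : 0 ≤ u) (hr : 0 ≤ r) : 0 ≤ hlsH γ u r := by
  unfold hlsH; split_ifs <;> positivity

lemma hls_pointwise (γ u v r : ℝ) (hγ : 0 < γ) (hγ1 : γ < 1) (hu : 0 ≤ u) (hv : 0 ≤ v)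
    (hr : 0 < r) :
    u ^ (1 - γ / 2) * v ^ (1 - γ / 2) * r ^ (-γ) ≤ u * v + hlsH γ u r + hlsH γ v r := by
  have n1 := hlsH_nonneg γ u r hu hr.le
  have n2 := hlsH_nonneg γ v r hv hr.le
  have n3 : 0 ≤ u * v := by positivity
  by_cases h1 : v ≤ u ∧ v * r ≤ 1
  · have := hls_aux γ u v r hγ hγ1 hu hv hr h1.1 h1.2; linarith
  by_cases h2 : u ≤ v ∧ u * r ≤ 1
  · have := hls_aux γ v u r hγ hγ1 hv hu hr h2.1 h2.2
    rw [mul_comm (v ^ _)] at this; linarith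
  have h3 : 1 < u * r ∧ 1 < v * r := by
    rcases le_total v u with h | h
    · have : 1 < v * r := by
        by_contra h'; exact h1 ⟨h, not_lt.mp h'⟩
      exact ⟨this.trans_le (by gcongr), this⟩
    · have : 1 < u * r := by
        by_contra h'; exact h2 ⟨h, not_lt.mp h'⟩
      exact ⟨this, this.trans_le (by gcongr)⟩
  have hu0 : 0 < u := by
    rcases hu.eq_or_lt with h | h
    · rw [← h] at h3; norm_num at h3
    · exact h
  have hv0 : 0 < v := by
    rcases hv.eq_or_lt with h | h
    · rw [← h] at h3; norm_num at h3
    · exact h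
  have key : r ^ (-γ) ≤ u ^ (γ/2) * v ^ (γ/2) := by
    have a1 : r⁻¹ ≤ u := by rw [← one_div, div_le_iff₀ hr]; exact h3.1.le
    have a2 : r⁻¹ ≤ v := by rw [← one_div, div_le_iff₀ hr]; exact h3.2.le
    have : r ^ (-γ) = (r⁻¹) ^ (γ/2) * (r⁻¹) ^ (γ/2) := by
      rw [← Real.rpow_add (by positivity), Real.inv_rpow hr.le, ← Real.rpow_neg hr.le]
      congr 1; ring
    rw [this]; gcongr
  have : u ^ (1 - γ / 2) * v ^ (1 - γ / 2) * r ^ (-γ) ≤ u * v := by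
    calc _ ≤ u ^ (1 - γ / 2) * v ^ (1 - γ / 2) * (u ^ (γ/2) * v ^ (γ/2)) := by gcongr
      _ = (u ^ (1 - γ / 2) * u ^ (γ/2)) * (v ^ (1 - γ / 2) * v ^ (γ/2)) := by ring
      _ = u * v := by
        rw [← Real.rpow_add hu0, ← Real.rpow_add hv0]; simp
  linarith

lemma hlsH_meas (γ : ℝ) : Measurable (fun p : ℝ × ℝ => hlsH γ p.1 p.2) := by
  unfold hlsH
  apply Measurable.ite
  · exact measurableSet_le (by fun_prop) (by fun_prop)
  · fun_prop
  · fun_prop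

lemma hlsH_half (γ u : ℝ) (hγ : 0 < γ) (hγ1 : γ < 1) (hu : 0 < u) :
    ∫⁻ r in Ioi (0:ℝ), ENNReal.ofReal (hlsH γ u r) ≤ ENNReal.ofReal ((1/(1-γ) + 2/γ) * u) := by
  have hsplit : Ioi (0:ℝ) = Ioc 0 (1/u) ∪ Ioi (1/u) := by
    rw [Ioc_union_Ioi_eq_Ioi]; positivity
  rw [hsplit]
  refine (lintegral_union_le _ _ _).trans ?_
  have e1 : ∫⁻ r in Ioc 0 (1/u), ENNReal.ofReal (hlsH γ u r) = ENNReal.ofReal (1/(1-γ) * u) := by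
    have : ∫⁻ r in Ioc 0 (1/u), ENNReal.ofReal (hlsH γ u r)
        = ∫⁻ r in Ioc 0 (1/u), ENNReal.ofReal (u ^ (2 - γ) * r ^ (-γ)) := by
      apply setLIntegral_congr_fun measurableSet_Ioc
      intro r hr
      have : u * r ≤ 1 := by
        have := hr.2; rw [le_div_iff₀ hu] at this; linarith
      simp [hlsH, this]
    rw [this, ← ofReal_integral_eq_lintegral_ofReal]
    · congr 1
      rw [← intervalIntegral.integral_of_le (by positivity), intervalIntegral.integral_const_mul,
        integral_rpow (Or.inl (by linarith))]
      rw [Real.zero_rpow (by linarith)]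
      have : u ^ (2-γ) * (1/u) ^ (-γ+1) = u := by
        rw [one_div, Real.inv_rpow hu.le, ← Real.rpow_neg hu.le, ← Real.rpow_add hu]
        ring_nf; simp
      calc _ = (u ^ (2-γ) * (1/u) ^ (-γ+1)) / (-γ+1) := by ring
        _ = _ := by rw [this]; ring
    · apply Integrable.const_mul
      rw [← IntegrableOn, ← intervalIntegrable_iff_integrableOn_Ioc_of_le (by positivity)]
      exact intervalIntegral.intervalIntegrable_rpow' (by linarith)
    · filter_upwards [ae_restrict_mem measurableSet_Ioc] with r hr
      have := hr.1
      simp only [Pi.zero_apply]; positivity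
  have e2 : ∫⁻ r in Ioi (1/u), ENNReal.ofReal (hlsH γ u r) = ENNReal.ofReal (2/γ * u) := by
    have : ∫⁻ r in Ioi (1/u), ENNReal.ofReal (hlsH γ u r)
        = ∫⁻ r in Ioi (1/u), ENNReal.ofReal (u ^ (1 - γ / 2) * r ^ (-(1 + γ / 2))) := by
      apply setLIntegral_congr_fun measurableSet_Ioi
      intro r hr
      have : ¬ (u * r ≤ 1) := by
        have : 1 / u < r := hr
        rw [div_lt_iff₀ hu] at this; linarith
      simp [hlsH, this]
    rw [this, ← ofReal_integral_eq_lintegral_ofReal]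
    · congr 1
      rw [integral_const_mul, integral_Ioi_rpow_of_lt (by linarith) (by positivity)]
      have : u ^ (1 - γ/2) * (1/u) ^ (-(1+γ/2)+1) = u := by
        rw [one_div, Real.inv_rpow hu.le, ← Real.rpow_neg hu.le, ← Real.rpow_add hu]
        ring_nf; simp
      calc _ = (u ^ (1 - γ/2) * (1/u) ^ (-(1+γ/2)+1)) * (-1 / (-(1+γ/2)+1)) := by ring
        _ = _ := by
          rw [this, show -(1 + γ/2) + 1 = -(γ/2) by ring]; field_simp
    · apply Integrable.const_mul
      exact integrableOn_Ioi_rpow_of_lt (by linarith) (by positivity)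
    · filter_upwards [ae_restrict_mem measurableSet_Ioi] with r hr
      have : 0 < r := lt_trans (by positivity : 0 < 1/u) hr
      simp only [Pi.zero_apply]; positivity
  rw [e1, e2, ← ENNReal.ofReal_add (by have : 0 < 1 - γ := by linarith
                                       positivity) (by positivity)]
  apply le_of_eq; congr 1; ring

lemma hlsH_line (γ u t : ℝ) (hγ : 0 < γ) (hγ1 : γ < 1) (hu : 0 ≤ u) :
    ∫⁻ s : ℝ, ENNReal.ofReal (hlsH γ u |t - s|) ≤
      ENNReal.ofReal ((2/(1-γ) + 4/γ) * u) := by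
  rcases hu.eq_or_lt with h | hu
  · subst h
    simp [hlsH, Real.zero_rpow (show (2 - γ) ≠ 0 by linarith)]
  have h1 : ∫⁻ s : ℝ, ENNReal.ofReal (hlsH γ u |t - s|)
      = ∫⁻ s : ℝ, ENNReal.ofReal (hlsH γ u |s|) :=
    lintegral_sub_left_eq_self (fun s => ENNReal.ofReal (hlsH γ u |s|)) t
  have h2 : (univ : Set ℝ) = Iic 0 ∪ Ioi 0 := by simp
  rw [h1, ← setLIntegral_univ, h2]
  refine (lintegral_union_le _ _ _).trans ?_
  have h3 : ∫⁻ r in Ioi (0:ℝ), ENNReal.ofReal (hlsH γ u |r|)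
      = ∫⁻ r in Ioi (0:ℝ), ENNReal.ofReal (hlsH γ u r) :=
    setLIntegral_congr_fun measurableSet_Ioi (fun r hr => by rw [abs_of_pos hr])
  have h4 : ∫⁻ r in Iic (0:ℝ), ENNReal.ofReal (hlsH γ u |r|)
      = ∫⁻ r in Ioi (0:ℝ), ENNReal.ofReal (hlsH γ u |r|) := by
    rw [setLIntegral_congr (Ioi_ae_eq_Ici (a := (0:ℝ)))]
    rw [← lintegral_indicator measurableSet_Iic, ← lintegral_indicator measurableSet_Ici,
      ← lintegral_neg_eq_self]
    congr 1; ext r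
    simp [indicator]
  rw [h4, h3]
  have := hlsH_half γ u hγ hγ1 hu
  calc _ ≤ ENNReal.ofReal ((1/(1-γ) + 2/γ) * u) + ENNReal.ofReal ((1/(1-γ) + 2/γ) * u) := by
        gcongr
    _ = _ := by
      have : 0 < 1 - γ := by linarith
      rw [← ENNReal.ofReal_add (by positivity) (by positivity)]; congr 1; ring

/-- HLS inequality on the line (bilinear, one function, normalised). -/
lemma hls_norm (γ : ℝ) (hγ : 0 < γ) (hγ1 : γ < 1) (S : Set ℝ) (u : ℝ → ℝ)
    (hum : Measurable u) (hu : ∀ t, 0 ≤ u t) (hint : ∫⁻ t in S, ENNReal.ofReal (u t) ≤ 1) :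
    ∫⁻ t in S, ∫⁻ s in S, ENNReal.ofReal
      (u t ^ (1 - γ / 2) * u s ^ (1 - γ / 2) * |t - s| ^ (-γ)) ≤
      ENNReal.ofReal (1 + 4/(1-γ) + 8/γ) := by
  have hγ2 : 0 < 1 - γ := by linarith
  have mm : Measurable (fun p : ℝ × ℝ => ENNReal.ofReal (hlsH γ (u p.1) |p.1 - p.2|)) := by
    apply ENNReal.measurable_ofReal.comp
    exact (hlsH_meas γ).comp (by fun_prop : Measurable fun p : ℝ × ℝ => (u p.1, |p.1 - p.2|))
  have mm' : Measurable (fun p : ℝ × ℝ => ENNReal.ofReal (hlsH γ (u p.2) |p.1 - p.2|)) := by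
    apply ENNReal.measurable_ofReal.comp
    exact (hlsH_meas γ).comp (by fun_prop : Measurable fun p : ℝ × ℝ => (u p.2, |p.1 - p.2|))
  have hpt : ∀ t s, ENNReal.ofReal (u t ^ (1 - γ / 2) * u s ^ (1 - γ / 2) * |t - s| ^ (-γ)) ≤
      ENNReal.ofReal (u t) * ENNReal.ofReal (u s) + ENNReal.ofReal (hlsH γ (u t) |t - s|)
        + ENNReal.ofReal (hlsH γ (u s) |t - s|) := by
    intro t s
    rcases (abs_nonneg (t-s)).eq_or_lt with h | h
    · rw [← h, Real.zero_rpow (by linarith)]; simp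
    · rw [← ENNReal.ofReal_mul (hu t), ← ENNReal.ofReal_add, ← ENNReal.ofReal_add]
      · exact ENNReal.ofReal_le_ofReal (hls_pointwise γ _ _ _ hγ hγ1 (hu t) (hu s) h)
      · have := hlsH_nonneg γ _ _ (hu t) h.le
        have := hu t; have := hu s; positivity
      · exact hlsH_nonneg γ _ _ (hu s) h.le
      · have := hu t; have := hu s; positivity
      · exact hlsH_nonneg γ _ _ (hu t) h.le
  have b1 : ∫⁻ t in S, ∫⁻ s in S, ENNReal.ofReal (hlsH γ (u t) |t - s|) ≤
      ENNReal.ofReal (2/(1-γ) + 4/γ) := by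
    calc _ ≤ ∫⁻ t in S, ENNReal.ofReal ((2/(1-γ) + 4/γ) * u t) := by
          apply lintegral_mono; intro t
          exact (setLIntegral_le_lintegral _ _).trans (hlsH_line γ (u t) t hγ hγ1 (hu t))
      _ = ENNReal.ofReal (2/(1-γ) + 4/γ) * ∫⁻ t in S, ENNReal.ofReal (u t) := by
          rw [← lintegral_const_mul _ (by fun_prop)]
          congr 1; ext t; rw [ENNReal.ofReal_mul (by positivity)]
      _ ≤ ENNReal.ofReal (2/(1-γ) + 4/γ) * 1 := by gcongr
      _ = _ := mul_one _
  have b2 : ∫⁻ t in S, ∫⁻ s in S, ENNReal.ofReal (hlsH γ (u s) |t - s|) ≤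
      ENNReal.ofReal (2/(1-γ) + 4/γ) := by
    rw [lintegral_lintegral_swap mm'.aemeasurable]
    simpa only [abs_sub_comm] using b1
  have b3 : ∫⁻ t in S, ∫⁻ s in S, ENNReal.ofReal (u t) * ENNReal.ofReal (u s) ≤ 1 := by
    calc _ = ∫⁻ t in S, ENNReal.ofReal (u t) * ∫⁻ s in S, ENNReal.ofReal (u s) := by
          congr 1; ext t; rw [lintegral_const_mul _ (by fun_prop)]
      _ = (∫⁻ t in S, ENNReal.ofReal (u t)) * ∫⁻ s in S, ENNReal.ofReal (u s) := by
          rw [lintegral_mul_const _ (by fun_prop)]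
      _ ≤ 1 * 1 := by gcongr
      _ = 1 := one_mul 1
  calc _ ≤ ∫⁻ t in S, ∫⁻ s in S, (ENNReal.ofReal (u t) * ENNReal.ofReal (u s)
        + ENNReal.ofReal (hlsH γ (u t) |t - s|) + ENNReal.ofReal (hlsH γ (u s) |t - s|)) :=
        lintegral_mono fun t => lintegral_mono fun s => hpt t s
    _ = (∫⁻ t in S, ∫⁻ s in S, ENNReal.ofReal (u t) * ENNReal.ofReal (u s))
        + (∫⁻ t in S, ∫⁻ s in S, ENNReal.ofReal (hlsH γ (u t) |t - s|))
        + ∫⁻ t in S, ∫⁻ s in S, ENNReal.ofReal (hlsH γ (u s) |t - s|) := by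
        rw [← lintegral_add_right _ mm.lintegral_prod_right',
          ← lintegral_add_right _ mm'.lintegral_prod_right']
        congr 1; ext t
        rw [← lintegral_add_right, ← lintegral_add_right]
        · exact mm'.comp (measurable_prodMk_left)
        · exact mm.comp (measurable_prodMk_left)
    _ ≤ 1 + ENNReal.ofReal (2/(1-γ) + 4/γ) + ENNReal.ofReal (2/(1-γ) + 4/γ) := by gcongr
    _ = _ := by
      rw [← ENNReal.ofReal_one, ← ENNReal.ofReal_add (by positivity) (by positivity),
        ← ENNReal.ofReal_add (by positivity) (by positivity)]
      congr 1; ring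

lemma hls (γ : ℝ) (hγ : 0 < γ) (hγ1 : γ < 1) (S : Set ℝ) (u : ℝ → ℝ)
    (hum : Measurable u) (hu : ∀ t, 0 ≤ u t) (V : ℝ) (hV : 0 < V)
    (hint : ∫⁻ t in S, ENNReal.ofReal (u t) ≤ ENNReal.ofReal V) :
    ∫⁻ t in S, ∫⁻ s in S, ENNReal.ofReal
      (u t ^ (1 - γ / 2) * u s ^ (1 - γ / 2) * |t - s| ^ (-γ)) ≤
      ENNReal.ofReal ((1 + 4/(1-γ) + 8/γ) * V ^ (2 - γ)) := by
  have hγ2 : 0 < 1 - γ := by linarith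
  have := hls_norm γ hγ hγ1 S (fun t => u t / V) (by fun_prop)
    (fun t => div_nonneg (hu t) hV.le) (by
      calc _ = ∫⁻ t in S, ENNReal.ofReal (V⁻¹) * ENNReal.ofReal (u t) := by
            congr 1; ext t; rw [← ENNReal.ofReal_mul (by positivity)]; congr 1; ring
        _ = ENNReal.ofReal (V⁻¹) * ∫⁻ t in S, ENNReal.ofReal (u t) := by
            rw [lintegral_const_mul _ (by fun_prop)]
        _ ≤ ENNReal.ofReal (V⁻¹) * ENNReal.ofReal V := by gcongr
        _ = 1 := by
            rw [← ENNReal.ofReal_mul (by positivity), inv_mul_cancel₀ hV.ne', ENNReal.ofReal_one])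
  calc _ = ENNReal.ofReal (V ^ (2 - γ)) * ∫⁻ t in S, ∫⁻ s in S, ENNReal.ofReal
          ((u t / V) ^ (1 - γ / 2) * (u s / V) ^ (1 - γ / 2) * |t - s| ^ (-γ)) := by
        have hmm : Measurable fun p : ℝ × ℝ => ENNReal.ofReal
          ((u p.1 / V) ^ (1 - γ / 2) * (u p.2 / V) ^ (1 - γ / 2) * |p.1 - p.2| ^ (-γ)) := by
          fun_prop
        rw [← lintegral_const_mul _ hmm.lintegral_prod_right']
        congr 1; ext t
        rw [← lintegral_const_mul _ (by fun_prop)]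
        congr 1; ext s
        rw [← ENNReal.ofReal_mul (by positivity)]
        congr 1
        rw [Real.div_rpow (hu t) hV.le, Real.div_rpow (hu s) hV.le]
        have : V ^ (2 - γ) = V ^ (1 - γ/2) * V ^ (1 - γ/2) := by
          rw [← Real.rpow_add hV]; congr 1; ring
        rw [this]
        have : V ^ (1 - γ/2) ≠ 0 := by positivity
        field_simp
    _ ≤ ENNReal.ofReal (V ^ (2 - γ)) * ENNReal.ofReal (1 + 4/(1-γ) + 8/γ) := by gcongr
    _ = _ := by rw [← ENNReal.ofReal_mul (by positivity), mul_comm]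


/-- Admissible functions for the interpolation lemma. -/
def SAdm {α : Type*} [MeasurableSpace α] (m : Measure α) (F : α → ℂ) : Prop :=
  Measurable F ∧ Integrable F m ∧ ∃ M : ℝ, ∀ x, ‖F x‖ ≤ M

lemma SAdm.ite {α : Type*} [MeasurableSpace α] {m : Measure α} {F : α → ℂ} (hF : SAdm m F)
    (s : Set α) (hs : MeasurableSet s) : SAdm m (s.indicator F) := by
  obtain ⟨h1, h2, M, h3⟩ := hF
  refine ⟨h1.indicator hs, h2.indicator hs, M, fun x => ?_⟩
  exact (norm_indicator_le_norm_self _ _).trans (h3 x)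

lemma SAdm.add {α : Type*} [MeasurableSpace α] {m : Measure α} {F G : α → ℂ} (hF : SAdm m F)
    (hG : SAdm m G) : SAdm m (F + G) := by
  obtain ⟨h1, h2, M, h3⟩ := hF
  obtain ⟨h1', h2', M', h3'⟩ := hG
  exact ⟨h1.add h1', h2.add h2', M + M', fun x => (norm_add_le _ _).trans
    (add_le_add (h3 x) (h3' x))⟩

/-- geometric sum: `∑_{2^n y < λ} 2^{nε} ≤ c (λ/y)^ε`. -/
lemma geom_tsum (ε : ℝ) (hε : 0 < ε) (y l : ℝ) (hy : 0 < y) (hl : 0 < l) :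
    ∑' n : ℤ, (if y < l * (2:ℝ) ^ (-n) then ENNReal.ofReal ((2:ℝ) ^ ((n:ℝ) * ε)) else 0) ≤
      ENNReal.ofReal ((1 - 2 ^ (-ε))⁻¹ * (l / y) ^ ε) := by
  have hq1 : (2:ℝ) ^ (-ε) < 1 := Real.rpow_lt_one_of_one_lt_of_neg (by norm_num) (by linarith)
  have hq0 : 0 < (2:ℝ) ^ (-ε) := by positivity
  set N : ℤ := Int.log 2 (l / y) with hN
  have hN1 : (2:ℝ) ^ N ≤ l / y := by
    have := Int.zpow_log_le_self (R := ℝ) (b := 2) (by norm_num) (show 0 < l / y by positivity)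
    simpa using this
  have hle : ∀ n : ℤ, y < l * (2:ℝ) ^ (-n) → n ≤ N := by
    intro n hn
    rw [hN, ← Int.zpow_le_iff_le_log (by norm_num) (by positivity)]
    rw [zpow_neg, ← div_eq_mul_inv, lt_div_iff₀ (by positivity)] at hn
    rw [le_div_iff₀ hy]; push_cast; nlinarith
  calc _ ≤ ∑' n : ℤ, (if n ≤ N then ENNReal.ofReal ((2:ℝ) ^ ((n:ℝ) * ε)) else 0) := by
        apply ENNReal.tsum_le_tsum
        intro n
        by_cases h : y < l * (2:ℝ) ^ (-n)
        · rw [if_pos h, if_pos (hle n h)]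
        · rw [if_neg h]; exact zero_le
    _ = ∑' n : ℤ, (if 0 ≤ n then ENNReal.ofReal ((2:ℝ) ^ (((N - n : ℤ):ℝ) * ε)) else 0) := by
        rw [← (Equiv.subLeft N).tsum_eq]
        congr 1; ext n
        simp
    _ = ∑' k : ℕ, ENNReal.ofReal ((2:ℝ) ^ (((N - (k:ℤ) : ℤ):ℝ) * ε)) := by
        have hinj : Function.Injective (fun k : ℕ => (k:ℤ)) := Nat.cast_injective
        rw [← hinj.tsum_eq]
        · simp
        · intro n hn
          rw [Function.mem_support] at hn
          have : 0 ≤ n := by by_contra h; simp [h] at hn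
          exact ⟨n.toNat, by simp [this]⟩
    _ = ∑' k : ℕ, ENNReal.ofReal ((2:ℝ) ^ ((N:ℝ) * ε) * ((2:ℝ) ^ (-ε)) ^ k) := by
        congr 1; ext k; congr 1
        rw [← Real.rpow_natCast, ← Real.rpow_mul (by norm_num), ← Real.rpow_add (by norm_num)]
        congr 1; push_cast; ring
    _ = ENNReal.ofReal ((2:ℝ) ^ ((N:ℝ) * ε) * (1 - 2 ^ (-ε))⁻¹) := by
        rw [← ENNReal.ofReal_tsum_of_nonneg (fun k => by positivity)
          ((summable_geometric_of_lt_one hq0.le hq1).mul_left _), tsum_mul_left,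
          tsum_geometric_of_lt_one hq0.le hq1]
    _ ≤ _ := by
        apply ENNReal.ofReal_le_ofReal
        rw [mul_comm]
        have : 0 < 1 - (2:ℝ) ^ (-ε) := by linarith
        gcongr
        rw [Real.rpow_mul (by norm_num), Real.rpow_intCast]
        gcongr

lemma amgm_ennreal (X Y : ℝ≥0∞) (c : ℝ) (hc : 0 < c) :
    X ^ (1/2:ℝ) * Y ^ (1/2:ℝ) ≤ ENNReal.ofReal c * X + ENNReal.ofReal c⁻¹ * Y := by
  have hcc : ENNReal.ofReal c * ENNReal.ofReal c⁻¹ = 1 := by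
    rw [← ENNReal.ofReal_mul hc.le, mul_inv_cancel₀ hc.ne', ENNReal.ofReal_one]
  have : X ^ (1/2:ℝ) * Y ^ (1/2:ℝ) =
      ((ENNReal.ofReal c * X) * (ENNReal.ofReal c⁻¹ * Y)) ^ (1/2:ℝ) := by
    rw [← ENNReal.mul_rpow_of_nonneg _ _ (by norm_num)]
    congr 1
    calc X * Y = (ENNReal.ofReal c * ENNReal.ofReal c⁻¹) * (X * Y) := by rw [hcc, one_mul]
      _ = _ := by ring
  rw [this]
  set P := ENNReal.ofReal c * X
  set Q := ENNReal.ofReal c⁻¹ * Y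
  calc (P * Q) ^ (1/2:ℝ) ≤ ((P + Q) * (P + Q)) ^ (1/2:ℝ) := by
        gcongr
        · exact le_self_add
        · exact le_add_self
    _ = P + Q := by
        rw [← sq, ← ENNReal.rpow_natCast, ← ENNReal.rpow_mul]; norm_num

lemma interp {α : Type*} [MeasurableSpace α] (m : Measure α) (p : ℝ) (hp1 : 1 < p) (hp2 : p < 2)
    (b : (α → ℂ) → (α → ℂ) → ℂ) (A D : ℝ≥0∞) (hDtop : D ≠ ∞)
    (hb1 : ∀ F F' G, SAdm m F → SAdm m F' → SAdm m G → b (F + F') G = b F G + b F' G)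
    (hb2 : ∀ F G G', SAdm m F → SAdm m G → SAdm m G' → b F (G + G') = b F G + b F G')
    (hA : ∀ F G, SAdm m F → SAdm m G → ‖b F G‖ₑ ≤
      A * ((∫⁻ x, ENNReal.ofReal (‖F x‖ ^ 2) ∂m) ^ (1/2:ℝ) *
        (∫⁻ x, ENNReal.ofReal (‖G x‖ ^ 2) ∂m) ^ (1/2:ℝ)))
    (hD : ∀ F G, SAdm m F → SAdm m G → ‖b F G‖ₑ ≤
      D * ((∫⁻ x, ENNReal.ofReal ‖F x‖ ∂m) * (∫⁻ x, ENNReal.ofReal ‖G x‖ ∂m)))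
    (F G : α → ℂ) (hF : SAdm m F) (hG : SAdm m G) (k l : ℝ) (hk : 0 < k) (hl : 0 < l) :
    ‖b F G‖ₑ ≤
      A * (ENNReal.ofReal (k * 2 ^ (2 - p)) * (∫⁻ x, ENNReal.ofReal (‖F x‖ ^ p) ∂m)
        + ENNReal.ofReal (k⁻¹ * ((1 - 2 ^ (-(2 - p)))⁻¹ * l ^ (2 - p))) *
          (∫⁻ x, ENNReal.ofReal (‖G x‖ ^ p) ∂m))
      + D * (ENNReal.ofReal (l ^ (1 - p)) * ((∫⁻ x, ENNReal.ofReal (‖F x‖ ^ p) ∂m) *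
          (∫⁻ x, ENNReal.ofReal (‖G x‖ ^ p) ∂m))) := by
  have hFm := hF.1
  have hGm := hG.1
  set lev : α → ℤ := fun x => ⌊Real.logb 2 ‖F x‖⌋ with hlev
  have hlevm : Measurable lev := by
    apply Int.measurable_floor.comp
    unfold Real.logb; fun_prop
  have hlev1 : ∀ x, F x ≠ 0 → (2:ℝ) ^ (lev x) ≤ ‖F x‖ := by
    intro x hx
    have h0 : 0 < ‖F x‖ := norm_pos_iff.mpr hx
    rw [← Real.rpow_intCast, ← Real.le_logb_iff_rpow_le (by norm_num) h0]
    exact Int.floor_le _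
  have hlev2 : ∀ x, F x ≠ 0 → ‖F x‖ ≤ (2:ℝ) ^ (lev x) * 2 := by
    intro x hx
    have h0 : 0 < ‖F x‖ := norm_pos_iff.mpr hx
    have : (2:ℝ) ^ (lev x) * 2 = (2:ℝ) ^ ((lev x : ℝ) + 1) := by
      rw [Real.rpow_add (by norm_num), Real.rpow_intCast]; simp
    rw [this, ← Real.logb_le_iff_le_rpow (by norm_num) h0]
    exact (Int.lt_floor_add_one _).le
  set Fn : ℤ → α → ℂ := fun n => (lev ⁻¹' {n}).indicator F with hFn
  have hFnS : ∀ n, SAdm m (Fn n) := fun n => hF.ite _ (hlevm (measurableSet_singleton n))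
  set Gl : ℤ → α → ℂ := fun n => ({x | ‖G x‖ < l * (2:ℝ) ^ (-n)}).indicator G with hGl
  set Gg : ℤ → α → ℂ := fun n => ({x | ‖G x‖ < l * (2:ℝ) ^ (-n)}ᶜ).indicator G with hGg
  have hsm : ∀ n : ℤ, MeasurableSet {x | ‖G x‖ < l * (2:ℝ) ^ (-n)} := fun n =>
    measurableSet_lt (by fun_prop) (by fun_prop)
  have hGlS : ∀ n, SAdm m (Gl n) := fun n => hG.ite _ (hsm n)
  have hGgS : ∀ n, SAdm m (Gg n) := fun n => hG.ite _ (hsm n).compl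
  have hGsum : ∀ n, Gl n + Gg n = G := fun n => Set.indicator_self_add_compl _ _
  -- zero
  have hSz : SAdm m (0 : α → ℂ) := ⟨measurable_zero, integrable_zero _ _ _, 0, by simp⟩
  have hb0 : b 0 G = 0 := by
    have := hb1 0 0 G hSz hSz hG
    simpa using this
  -- finite sums
  have hfin : ∀ s : Finset ℤ, SAdm m (∑ n ∈ s, Fn n) ∧
      ‖b (∑ n ∈ s, Fn n) G‖ₑ ≤ ∑ n ∈ s, ‖b (Fn n) G‖ₑ := by
    intro s
    induction s using Finset.induction_on with
    | empty => simp [hSz, hb0]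
    | insert n s hn ih =>
      rw [Finset.sum_insert hn, Finset.sum_insert hn]
      refine ⟨(hFnS n).add ih.1, ?_⟩
      rw [hb1 _ _ _ (hFnS n) ih.1 hG]
      exact (enorm_add_le _ _).trans (by gcongr; exact ih.2)
  have hrem_eq : ∀ (s : Finset ℤ) x, (∑ n ∈ s, Fn n) x = if lev x ∈ s then F x else 0 := by
    intro s x
    have hone : ∀ n, Fn n x = if lev x = n then F x else 0 := by
      intro n
      by_cases h : lev x = n
      · rw [if_pos h]; exact Set.indicator_of_mem (by simpa using h) _
      · rw [if_neg h]; exact Set.indicator_of_notMem (by simpa using h) _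
    rw [Finset.sum_apply]
    simp_rw [hone]
    simp
  set rem : Finset ℤ → α → ℂ := fun s => (lev ⁻¹' (s : Set ℤ)ᶜ).indicator F with hrem
  have hremS : ∀ s, SAdm m (rem s) := fun s => hF.ite _ (hlevm (MeasurableSet.of_discrete))
  have hsplit : ∀ s : Finset ℤ, F = (∑ n ∈ s, Fn n) + rem s := by
    intro s; ext x
    rw [Pi.add_apply, hrem_eq]
    by_cases h : lev x ∈ s <;> simp [hrem, h]
  have hlim : Filter.Tendsto (fun s : Finset ℤ => ∫⁻ x, ENNReal.ofReal ‖rem s x‖ ∂m)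
      Filter.atTop (nhds 0) := by
    have := tendsto_lintegral_filter_of_dominated_convergence (μ := m)
      (l := (Filter.atTop : Filter (Finset ℤ)))
      (F := fun s x => ENNReal.ofReal ‖rem s x‖) (f := fun _ => 0)
      (fun x => ENNReal.ofReal ‖F x‖) ?_ ?_ ?_ ?_
    · simpa using this
    · exact Filter.Eventually.of_forall fun s => by
        have := (hremS s).1; fun_prop
    · exact Filter.Eventually.of_forall fun s => Filter.Eventually.of_forall fun x =>
        ENNReal.ofReal_le_ofReal (norm_indicator_le_norm_self _ _)
    · have h2 := hF.2.1.norm.lintegral_lt_top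
      exact h2.ne
    · refine Filter.Eventually.of_forall fun x => ?_
      apply tendsto_const_nhds.congr'
      filter_upwards [Filter.eventually_ge_atTop {lev x}] with s hs
      have : lev x ∈ s := hs (by simp)
      simp [hrem, this]
  have hmain : ‖b F G‖ₑ ≤ ∑' n, ‖b (Fn n) G‖ₑ := by
    have h1 : ∀ s : Finset ℤ, ‖b F G‖ₑ ≤ (∑' n, ‖b (Fn n) G‖ₑ) +
        D * ((∫⁻ x, ENNReal.ofReal ‖rem s x‖ ∂m) * (∫⁻ x, ENNReal.ofReal ‖G x‖ ∂m)) := by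
      intro s
      conv_lhs => rw [hsplit s]
      rw [hb1 _ _ _ (hfin s).1 (hremS s) hG]
      refine (enorm_add_le _ _).trans ?_
      gcongr
      · exact (hfin s).2.trans (ENNReal.sum_le_tsum s)
      · exact hD _ _ (hremS s) hG
    have hGfin : (∫⁻ x, ENNReal.ofReal ‖G x‖ ∂m) ≠ ∞ := hG.2.1.norm.lintegral_lt_top.ne
    have h2 : Filter.Tendsto (fun s : Finset ℤ => (∑' n, ‖b (Fn n) G‖ₑ) +
        D * ((∫⁻ x, ENNReal.ofReal ‖rem s x‖ ∂m) * (∫⁻ x, ENNReal.ofReal ‖G x‖ ∂m)))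
        Filter.atTop (nhds ((∑' n, ‖b (Fn n) G‖ₑ) +
          D * (0 * (∫⁻ x, ENNReal.ofReal ‖G x‖ ∂m)))) := by
      apply Filter.Tendsto.add tendsto_const_nhds
      apply ENNReal.Tendsto.const_mul _ (Or.inr hDtop)
      exact ENNReal.Tendsto.mul_const hlim (Or.inr hGfin)
    have := ge_of_tendsto' h2 h1
    simpa using this
  -- per-level bound
  have hlevel : ∀ n, ‖b (Fn n) G‖ₑ ≤
      A * (ENNReal.ofReal k * (ENNReal.ofReal ((2:ℝ) ^ ((n:ℝ) * (p - 2))) *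
            ∫⁻ x, ENNReal.ofReal (‖Fn n x‖ ^ 2) ∂m)
        + ENNReal.ofReal k⁻¹ * (ENNReal.ofReal ((2:ℝ) ^ ((n:ℝ) * (2 - p))) *
            ∫⁻ x, ENNReal.ofReal (‖Gl n x‖ ^ 2) ∂m))
      + D * (∫⁻ x, ENNReal.ofReal ‖Fn n x‖ ∂m) * (∫⁻ x, ENNReal.ofReal ‖Gg n x‖ ∂m) := by
    intro n
    conv_lhs => rw [← hGsum n]
    rw [hb2 _ _ _ (hFnS n) (hGlS n) (hGgS n)]
    refine (enorm_add_le _ _).trans ?_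
    gcongr
    · refine (hA _ _ (hFnS n) (hGlS n)).trans ?_
      gcongr
      refine (amgm_ennreal _ _ (k * (2:ℝ) ^ ((n:ℝ) * (p - 2))) (by positivity)).trans ?_
      rw [mul_inv, ← Real.rpow_neg (by norm_num), ENNReal.ofReal_mul hk.le,
        ENNReal.ofReal_mul (by positivity), mul_assoc, mul_assoc,
        show -((n:ℝ) * (p - 2)) = n * (2 - p) by ring]
    · rw [mul_assoc]; exact hD _ _ (hFnS n) (hGgS n)
  -- the three sums
  have s1 : ∑' n : ℤ, (ENNReal.ofReal ((2:ℝ) ^ ((n:ℝ) * (p - 2))) *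
            ∫⁻ x, ENNReal.ofReal (‖Fn n x‖ ^ 2) ∂m) ≤
        ENNReal.ofReal (2 ^ (2 - p)) * ∫⁻ x, ENNReal.ofReal (‖F x‖ ^ p) ∂m := by
    have hmeas : ∀ n, Measurable fun x => ENNReal.ofReal (‖Fn n x‖ ^ 2) := fun n => by
      have := (hFnS n).1; fun_prop
    simp_rw [← fun n : ℤ => lintegral_const_mul (μ := m) (ENNReal.ofReal ((2:ℝ) ^ ((n:ℝ) * (p - 2))))
      (hmeas n)]
    rw [← lintegral_tsum (fun n => ((hmeas n).const_mul _).aemeasurable),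
      ← lintegral_const_mul _ (by fun_prop)]
    apply lintegral_mono
    intro x
    dsimp only
    rw [tsum_eq_single (lev x)]
    · by_cases hx : F x = 0
      · simp [hFn, hx]
      have h0 : 0 < ‖F x‖ := norm_pos_iff.mpr hx
      rw [← ENNReal.ofReal_mul (by positivity), ← ENNReal.ofReal_mul (by positivity)]
      apply ENNReal.ofReal_le_ofReal
      have e : Fn (lev x) x = F x := by simp [hFn]
      rw [e, Real.rpow_mul (by norm_num), Real.rpow_intCast]
      have h1 : ((2:ℝ) ^ (lev x)) ^ (p - 2) ≤ (‖F x‖ / 2) ^ (p - 2) := by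
        apply Real.rpow_le_rpow_of_nonpos (by positivity) _ (by linarith)
        have := hlev2 x hx; linarith
      calc _ ≤ (‖F x‖ / 2) ^ (p - 2) * ‖F x‖ ^ 2 := by gcongr
        _ = 2 ^ (2 - p) * ‖F x‖ ^ p := by
          rw [Real.div_rpow h0.le (by norm_num), div_eq_mul_inv, ← Real.rpow_neg (by norm_num),
            ← Real.rpow_natCast, mul_right_comm, ← Real.rpow_add h0]
          push_cast; rw [mul_comm]; ring_nf
    · intro n hn
      have : Fn n x = 0 := by
        apply Set.indicator_of_notMem
        intro h; exact hn (by simpa using h.symm)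
      simp [this]
  have s2 : ∑' n : ℤ, (ENNReal.ofReal ((2:ℝ) ^ ((n:ℝ) * (2 - p))) *
            ∫⁻ x, ENNReal.ofReal (‖Gl n x‖ ^ 2) ∂m) ≤
        ENNReal.ofReal ((1 - 2 ^ (-(2 - p)))⁻¹ * l ^ (2 - p)) *
          ∫⁻ x, ENNReal.ofReal (‖G x‖ ^ p) ∂m := by
    have hmeas : ∀ n, Measurable fun x => ENNReal.ofReal (‖Gl n x‖ ^ 2) := fun n => by
      have := (hGlS n).1; fun_prop
    simp_rw [← fun n : ℤ => lintegral_const_mul (μ := m) (ENNReal.ofReal ((2:ℝ) ^ ((n:ℝ) * (2 - p))))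
      (hmeas n)]
    rw [← lintegral_tsum (fun n => ((hmeas n).const_mul _).aemeasurable),
      ← lintegral_const_mul _ (by fun_prop)]
    apply lintegral_mono
    intro x
    dsimp only
    by_cases hx : G x = 0
    · simp [hGl, Set.indicator_apply, hx]
    have h0 : 0 < ‖G x‖ := norm_pos_iff.mpr hx
    have hq1 : (2:ℝ) ^ (-(2-p)) < 1 :=
      Real.rpow_lt_one_of_one_lt_of_neg (by norm_num) (by linarith)
    have hq2 : 0 < 1 - (2:ℝ) ^ (-(2-p)) := by linarith
    calc _ = ∑' n : ℤ, (if ‖G x‖ < l * (2:ℝ) ^ (-n) then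
              ENNReal.ofReal ((2:ℝ) ^ ((n:ℝ) * (2 - p))) else 0) *
              ENNReal.ofReal (‖G x‖ ^ 2) := by
          congr 1; ext n
          by_cases h : ‖G x‖ < l * (2:ℝ) ^ (-n)
          · simp only [hGl, Set.indicator_apply, Set.mem_ofPred_eq, if_pos h]
          · simp only [hGl, Set.indicator_apply, Set.mem_ofPred_eq, if_neg h]; simp
      _ ≤ ENNReal.ofReal ((1 - 2 ^ (-(2 - p)))⁻¹ * (l / ‖G x‖) ^ (2 - p)) *
            ENNReal.ofReal (‖G x‖ ^ 2) := by
          rw [ENNReal.tsum_mul_right]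
          gcongr
          exact geom_tsum (2 - p) (by linarith) _ l h0 hl
      _ = _ := by
          rw [← ENNReal.ofReal_mul (by positivity), ← ENNReal.ofReal_mul (by positivity)]
          congr 1
          rw [Real.div_rpow hl.le h0.le, div_eq_mul_inv, ← Real.rpow_neg h0.le, mul_assoc,
            mul_assoc, mul_assoc, ← Real.rpow_natCast, ← Real.rpow_add h0]
          push_cast; ring_nf
  have g1 : ∀ n : ℤ, ∫⁻ x, ENNReal.ofReal ‖Gg n x‖ ∂m ≤
      ENNReal.ofReal (l ^ (1 - p) * (2:ℝ) ^ ((n:ℝ) * (p - 1))) *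
        ∫⁻ x, ENNReal.ofReal (‖G x‖ ^ p) ∂m := by
    intro n
    rw [← lintegral_const_mul _ (by fun_prop)]
    apply lintegral_mono
    intro x
    dsimp only
    rw [← ENNReal.ofReal_mul (by positivity)]
    apply ENNReal.ofReal_le_ofReal
    by_cases h : ‖G x‖ < l * (2:ℝ) ^ (-n)
    · have : Gg n x = 0 := Set.indicator_of_notMem (by simpa using h) _
      rw [this, norm_zero]; positivity
    · have e : Gg n x = G x := Set.indicator_of_mem (by simpa using h) _
      rw [e]
      have hpos : 0 < l * (2:ℝ) ^ (-n) := by positivity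
      have h' : l * (2:ℝ) ^ (-n) ≤ ‖G x‖ := not_lt.mp h
      have h0 : 0 < ‖G x‖ := hpos.trans_le h'
      have h1 : ‖G x‖ ^ (1 - p) ≤ (l * (2:ℝ) ^ (-n)) ^ (1 - p) :=
        Real.rpow_le_rpow_of_nonpos hpos h' (by linarith)
      have h2 : (l * (2:ℝ) ^ (-n)) ^ (1 - p) = l ^ (1 - p) * (2:ℝ) ^ ((n:ℝ) * (p - 1)) := by
        rw [Real.mul_rpow hl.le (by positivity), ← Real.rpow_intCast, ← Real.rpow_mul (by norm_num)]
        congr 2; push_cast; ring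
      rw [h2] at h1
      calc ‖G x‖ = ‖G x‖ ^ (1 - p) * ‖G x‖ ^ p := by rw [← Real.rpow_add h0]; simp
        _ ≤ _ := by gcongr
  have s3' : ∑' n : ℤ, (ENNReal.ofReal ((2:ℝ) ^ ((n:ℝ) * (p - 1))) *
            ∫⁻ x, ENNReal.ofReal ‖Fn n x‖ ∂m) ≤ ∫⁻ x, ENNReal.ofReal (‖F x‖ ^ p) ∂m := by
    have hmeas : ∀ n, Measurable fun x => ENNReal.ofReal ‖Fn n x‖ := fun n => by
      have := (hFnS n).1; fun_prop
    simp_rw [← fun n : ℤ => lintegral_const_mul (μ := m) (ENNReal.ofReal ((2:ℝ) ^ ((n:ℝ) * (p - 1))))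
      (hmeas n)]
    rw [← lintegral_tsum (fun n => ((hmeas n).const_mul _).aemeasurable)]
    apply lintegral_mono
    intro x
    dsimp only
    rw [tsum_eq_single (lev x)]
    · by_cases hx : F x = 0
      · simp [hFn, hx]
      have h0 : 0 < ‖F x‖ := norm_pos_iff.mpr hx
      rw [← ENNReal.ofReal_mul (by positivity)]
      apply ENNReal.ofReal_le_ofReal
      have e : Fn (lev x) x = F x := by simp [hFn]
      rw [e, Real.rpow_mul (by norm_num), Real.rpow_intCast]
      have h1 : ((2:ℝ) ^ (lev x)) ^ (p - 1) ≤ ‖F x‖ ^ (p - 1) :=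
        Real.rpow_le_rpow (by positivity) (hlev1 x hx) (by linarith)
      calc _ ≤ ‖F x‖ ^ (p - 1) * ‖F x‖ := by gcongr
        _ = ‖F x‖ ^ p := by
          nth_rewrite 2 [← Real.rpow_one ‖F x‖]
          rw [← Real.rpow_add h0]; ring_nf
    · intro n hn
      have : Fn n x = 0 := by
        apply Set.indicator_of_notMem
        intro h; exact hn (by simpa using h.symm)
      simp [this]
  set X := ∫⁻ x, ENNReal.ofReal (‖F x‖ ^ p) ∂m
  set Y := ∫⁻ x, ENNReal.ofReal (‖G x‖ ^ p) ∂m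
  have s3 : ∑' n : ℤ, (D * (∫⁻ x, ENNReal.ofReal ‖Fn n x‖ ∂m) *
      (∫⁻ x, ENNReal.ofReal ‖Gg n x‖ ∂m)) ≤ D * (ENNReal.ofReal (l ^ (1 - p)) * (X * Y)) := by
    calc _ ≤ ∑' n : ℤ, (D * ENNReal.ofReal (l ^ (1 - p)) * Y) *
          (ENNReal.ofReal ((2:ℝ) ^ ((n:ℝ) * (p - 1))) *
            ∫⁻ x, ENNReal.ofReal ‖Fn n x‖ ∂m) := by
          apply ENNReal.tsum_le_tsum
          intro n
          calc _ ≤ D * (∫⁻ x, ENNReal.ofReal ‖Fn n x‖ ∂m) *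
                (ENNReal.ofReal (l ^ (1 - p) * (2:ℝ) ^ ((n:ℝ) * (p - 1))) * Y) := by
                gcongr; exact g1 n
            _ = _ := by rw [ENNReal.ofReal_mul (by positivity)]; ring
      _ ≤ (D * ENNReal.ofReal (l ^ (1 - p)) * Y) * X := by
          rw [ENNReal.tsum_mul_left]; gcongr
      _ = _ := by ring
  calc _ ≤ ∑' n, ‖b (Fn n) G‖ₑ := hmain
    _ ≤ _ := ENNReal.tsum_le_tsum hlevel
    _ ≤ _ := by
      rw [ENNReal.tsum_add, ENNReal.tsum_mul_left, ENNReal.tsum_add, ENNReal.tsum_mul_left,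
        ENNReal.tsum_mul_left, ENNReal.ofReal_mul hk.le, ENNReal.ofReal_mul (inv_nonneg.mpr hk.le),
        mul_assoc, mul_assoc]
      gcongr


lemma opt_alg (p A D X Y : ℝ) (hp : 0 < p) (hA : 0 < A) (hD : 0 < D)
    (hX : 0 < X) (hY : 0 < Y) : ∃ k l : ℝ, 0 < k ∧ 0 < l ∧
    A * (k * X) = A ^ (2 - 2/p) * D ^ (2/p - 1) * (X ^ (1/p) * Y ^ (1/p)) ∧
    A * (k⁻¹ * l ^ (2 - p) * Y) = A ^ (2 - 2/p) * D ^ (2/p - 1) * (X ^ (1/p) * Y ^ (1/p)) ∧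
    D * (l ^ (1 - p) * (X * Y)) = A ^ (2 - 2/p) * D ^ (2/p - 1) * (X ^ (1/p) * Y ^ (1/p)) := by
  obtain ⟨a, rfl⟩ : ∃ a, A = Real.exp a := ⟨Real.log A, (Real.exp_log hA).symm⟩
  obtain ⟨e, rfl⟩ : ∃ a, D = Real.exp a := ⟨Real.log D, (Real.exp_log hD).symm⟩
  obtain ⟨x, rfl⟩ : ∃ a, X = Real.exp a := ⟨Real.log X, (Real.exp_log hX).symm⟩
  obtain ⟨y, rfl⟩ : ∃ a, Y = Real.exp a := ⟨Real.log Y, (Real.exp_log hY).symm⟩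
  refine ⟨Real.exp ((1 - p/2) * ((2/p) * (e - a) + (1/p) * (x + y)) + y/2 - x/2),
    Real.exp ((2/p) * (e - a) + (1/p) * (x + y)), Real.exp_pos _, Real.exp_pos _, ?_, ?_, ?_⟩
  all_goals
    simp only [← Real.exp_neg, ← Real.exp_mul, ← Real.exp_add]
    congr 1
    field_simp
    ring

lemma interp2 {α : Type*} [MeasurableSpace α] (m : Measure α) (p : ℝ) (hp1 : 1 < p) (hp2 : p < 2)
    (b : (α → ℂ) → (α → ℂ) → ℂ) (A D : ℝ) (hA0 : 0 < A) (hD0 : 0 < D)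
    (hb1 : ∀ F F' G, SAdm m F → SAdm m F' → SAdm m G → b (F + F') G = b F G + b F' G)
    (hb2 : ∀ F G G', SAdm m F → SAdm m G → SAdm m G' → b F (G + G') = b F G + b F G')
    (hA : ∀ F G, SAdm m F → SAdm m G → ‖b F G‖ₑ ≤
      ENNReal.ofReal A * ((∫⁻ x, ENNReal.ofReal (‖F x‖ ^ 2) ∂m) ^ (1/2:ℝ) *
        (∫⁻ x, ENNReal.ofReal (‖G x‖ ^ 2) ∂m) ^ (1/2:ℝ)))
    (hD : ∀ F G, SAdm m F → SAdm m G → ‖b F G‖ₑ ≤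
      ENNReal.ofReal D * ((∫⁻ x, ENNReal.ofReal ‖F x‖ ∂m) * (∫⁻ x, ENNReal.ofReal ‖G x‖ ∂m)))
    (F G : α → ℂ) (hF : SAdm m F) (hG : SAdm m G) :
    ‖b F G‖ₑ ≤ ENNReal.ofReal ((2 ^ (2 - p) + (1 - 2 ^ (-(2 - p)))⁻¹ + 1) *
      (A ^ (2 - 2/p) * D ^ (2/p - 1) *
        ((∫ x, ‖F x‖ ^ p ∂m) ^ (1/p) * (∫ x, ‖G x‖ ^ p ∂m) ^ (1/p)))) := by
  have hq1 : (2:ℝ) ^ (-(2-p)) < 1 :=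
    Real.rpow_lt_one_of_one_lt_of_neg (by norm_num) (by linarith)
  have hq2 : 0 < 1 - (2:ℝ) ^ (-(2-p)) := by linarith
  have hint : ∀ F, SAdm m F → Integrable (fun x => ‖F x‖ ^ p) m := by
    rintro F ⟨h1, h2, M, h3⟩
    refine (h2.norm.const_mul (M ^ (p-1))).mono' ?_ ?_
    · exact (by fun_prop : Measurable fun x => ‖F x‖ ^ p).aestronglyMeasurable
    · refine Filter.Eventually.of_forall fun x => ?_
      rw [Real.norm_of_nonneg (by positivity)]
      rcases (norm_nonneg (F x)).eq_or_lt with h | h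
      · rw [← h, Real.zero_rpow (by linarith)]; simp
      · calc ‖F x‖ ^ p = ‖F x‖ ^ (p - 1) * ‖F x‖ := by
              nth_rewrite 3 [← Real.rpow_one ‖F x‖]
              rw [← Real.rpow_add h]; ring_nf
          _ ≤ _ := by
              gcongr
              exact h3 x
  have hlint : ∀ F, SAdm m F → ∫⁻ x, ENNReal.ofReal (‖F x‖ ^ p) ∂m =
      ENNReal.ofReal (∫ x, ‖F x‖ ^ p ∂m) := by
    intro F hF
    rw [ofReal_integral_eq_lintegral_ofReal (hint F hF)]
    exact Filter.Eventually.of_forall fun x => by positivity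
  have hzero : ∀ F, SAdm m F → ∫ x, ‖F x‖ ^ p ∂m = 0 → ∫⁻ x, ENNReal.ofReal ‖F x‖ ∂m = 0 := by
    intro F hF h
    rw [integral_eq_zero_iff_of_nonneg (fun x => by positivity) (hint F hF)] at h
    have : (fun x => ENNReal.ofReal ‖F x‖) =ᵐ[m] 0 := by
      filter_upwards [h] with x hx
      have hx' : ‖F x‖ ^ p = 0 := hx
      rw [Real.rpow_eq_zero (norm_nonneg _) (by linarith)] at hx'
      simp [hx']
    rw [lintegral_congr_ae this]; simp
  have hX0 : 0 ≤ ∫ x, ‖F x‖ ^ p ∂m := integral_nonneg fun x => by positivity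
  have hY0 : 0 ≤ ∫ x, ‖G x‖ ^ p ∂m := integral_nonneg fun x => by positivity
  rcases hX0.eq_or_lt with h | hX
  · refine (hD F G hF hG).trans ?_
    rw [hzero F hF h.symm]; simp
  rcases hY0.eq_or_lt with h | hY
  · refine (hD F G hF hG).trans ?_
    rw [hzero G hG h.symm]; simp
  obtain ⟨k, l, hk, hl, e1, e2, e3⟩ := opt_alg p A D _ _ (by linarith) hA0 hD0 hX hY
  refine (interp m p hp1 hp2 b _ _ ENNReal.ofReal_ne_top hb1 hb2 hA hD F G hF hG k l hk hl).trans ?_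
  rw [hlint F hF, hlint G hG]
  set X := ∫ x, ‖F x‖ ^ p ∂m
  set Y := ∫ x, ‖G x‖ ^ p ∂m
  set R := A ^ (2 - 2/p) * D ^ (2/p - 1) * (X ^ (1/p) * Y ^ (1/p))
  rw [← ENNReal.ofReal_mul (by positivity), ← ENNReal.ofReal_mul (by positivity),
    ← ENNReal.ofReal_mul (by positivity), ← ENNReal.ofReal_mul (by positivity),
    ← ENNReal.ofReal_add (by positivity) (by positivity),
    ← ENNReal.ofReal_mul (by positivity), ← ENNReal.ofReal_mul (by positivity),
    ← ENNReal.ofReal_add (by positivity) (by positivity)]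
  apply le_of_eq
  congr 1
  calc _ = 2 ^ (2 - p) * (A * (k * X)) + (1 - 2 ^ (-(2 - p)))⁻¹ * (A * (k⁻¹ * l ^ (2 - p) * Y))
      + D * (l ^ (1 - p) * (X * Y)) := by ring
    _ = _ := by rw [e1, e2, e3]; ring


abbrev EE (d : ℕ) := EuclideanSpace ℝ (Fin d)

lemma fourier_cont (F : EE d → ℂ) (hF : Integrable F) : Continuous (𝓕 F) := by
  have := VectorFourier.fourierIntegral_continuous (e := Real.fourierChar) (μ := (volume : Measure (EE d)))
    (L := innerₗ (EE d)) Real.continuous_fourierChar continuous_inner hF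
  exact this

lemma fourier_flip (F G : EE d → ℂ) (hF : Integrable F) (hG : Integrable G) :
    ∫ ξ, 𝓕 F ξ * G ξ = ∫ x, F x * 𝓕 G x := by
  have := VectorFourier.integral_fourierIntegral_smul_eq_flip (e := Real.fourierChar)
    (μ := (volume : Measure (EE d))) (ν := (volume : Measure (EE d)))
    (L := innerₗ (EE d)) Real.continuous_fourierChar continuous_inner hF hG
  rw [flip_innerₗ] at this
  exact this

lemma bessel (F : EE d → ℂ) (hF : Integrable F) (hF2 : MemLp F 2) :
    ∫⁻ ξ, ENNReal.ofReal (‖𝓕 F ξ‖ ^ 2) = ∫⁻ x, ENNReal.ofReal (‖F x‖ ^ 2) := by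
  have hae : ∀ᵐ ξ, (𝓕 (hF2.toLp F) : Lp ℂ 2 (volume : Measure (EE d))) ξ = 𝓕 F ξ := by
    apply ae_eq_of_integral_contDiff_smul_eq
    · exact (Lp.memLp _).locallyIntegrable (by norm_num)
    · exact (fourier_cont F hF).locallyIntegrable
    · intro g hg1 hg2
      let g' : EE d → ℂ := fun x => (g x : ℂ)
      have hg1' : ContDiff ℝ (⊤ : ℕ∞) g' := Complex.ofRealCLM.contDiff.comp hg1
      have hg2' : HasCompactSupport g' := hg2.comp_left (g := fun y : ℝ => (y : ℂ)) (by simp)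
      let φ : SchwartzMap (EE d) ℂ := hg2'.toSchwartzMap hg1'
      have h := congrArg (fun T => T φ) (MeasureTheory.Lp.fourier_toTemperedDistribution_eq (hF2.toLp F))
      simp only [TemperedDistribution.fourier_apply, Lp.toTemperedDistribution_apply] at h
      have e1 : ∀ x, g x • (𝓕 (hF2.toLp F) : Lp ℂ 2 (volume : Measure (EE d))) x = φ x • (𝓕 (hF2.toLp F) : Lp ℂ 2 (volume : Measure (EE d))) x := by
        intro x
        change _ = (g x : ℂ) • _
        simp
      simp_rw [e1]
      rw [← h]
      have e2 : ∀ x, g x • 𝓕 F x = 𝓕 F x * φ x := by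
        intro x
        change _ = _ * (g x : ℂ)
        simp [mul_comm]
      simp_rw [e2]
      rw [fourier_flip F φ hF φ.integrable]
      apply integral_congr_ae
      filter_upwards [hF2.coeFn_toLp] with x hx
      rw [hx, smul_eq_mul, mul_comm, SchwartzMap.fourier_coe]
  have hn := MeasureTheory.Lp.norm_fourier_eq (hF2.toLp F)
  have hn' : ‖(𝓕 (hF2.toLp F) : Lp ℂ 2 (volume : Measure (EE d)))‖ₑ = ‖hF2.toLp F‖ₑ := by
    rw [← ofReal_norm, hn, ofReal_norm]
  rw [Lp.enorm_def, Lp.enorm_def, eLpNorm_congr_ae hae, eLpNorm_congr_ae hF2.coeFn_toLp] at hn'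
  rw [eLpNorm_eq_lintegral_rpow_enorm_toReal (by norm_num) (by norm_num), eLpNorm_eq_lintegral_rpow_enorm_toReal (by norm_num) (by norm_num)] at hn'
  have := ENNReal.rpow_left_injective (by norm_num) hn'
  have e : ∀ z : ℂ, ENNReal.ofReal (‖z‖ ^ 2) = ‖z‖ₑ ^ (2:ENNReal).toReal := by
    intro z
    rw [ENNReal.ofReal_pow (norm_nonneg _), ofReal_norm]
    simp
  simp_rw [e]
  exact this


lemma fourier_modul (n : EE d → ℂ) (z w : EE d) :
    𝓕 (fun ξ => (Real.fourierChar (-⟪ξ, z⟫) : ℂ) * n ξ) w = 𝓕 n (z + w) := by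
  rw [Real.fourier_eq, Real.fourier_eq]
  congr 1; ext ξ
  simp only [Circle.smul_def, smul_eq_mul, inner_add_right, neg_add, AddChar.map_add_eq_mul,
    Circle.coe_mul]
  ring

lemma fourier_modul_int (n : EE d → ℂ) (hn : Integrable n) (z : EE d) :
    Integrable (fun ξ => (Real.fourierChar (-⟪ξ, z⟫) : ℂ) * n ξ) := by
  have hc : Continuous (fun ξ : EE d => (Real.fourierChar (-⟪ξ, z⟫) : ℂ)) := by
    have := Real.continuous_fourierChar
    fun_prop
  exact hn.bdd_mul (c := 1) hc.aestronglyMeasurable (Filter.Eventually.of_forall fun x => (Circle.norm_coe _).le)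

lemma fourier_mul_bound (P n : EE d → ℂ) (hP : Integrable P) (hn : Integrable n) (D : ℝ)
    (hD : ∀ z, ‖𝓕 n z‖ ≤ D) (z : EE d) :
    ‖𝓕 (fun ξ => 𝓕 P ξ * n ξ) z‖ ≤ D * ∫ x, ‖P x‖ := by
  have e1 : 𝓕 (fun ξ => 𝓕 P ξ * n ξ) z = ∫ x, P x * 𝓕 n (z + x) := by
    have := fourier_flip P _ hP (fourier_modul_int n hn z)
    simp_rw [fourier_modul] at this
    rw [← this, Real.fourier_eq]
    congr 1; ext ξ
    simp only [Circle.smul_def, smul_eq_mul]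
    ring
  rw [e1, ← integral_const_mul]
  apply norm_integral_le_of_norm_le (hP.norm.const_mul D)
  refine Filter.Eventually.of_forall fun x => ?_
  rw [norm_mul, mul_comm]
  exact mul_le_mul_of_nonneg_right (hD _) (norm_nonneg _)

/-- the bilinear form -/
def bil (m : EE d → ℂ) (F G : EE d → ℂ) : ℂ :=
  ∫ ξ, m ξ * (𝓕 F ξ * (starRingEnd ℂ) (𝓕 G ξ))

lemma fourier_conj (G : EE d → ℂ) (ξ : EE d) :
    (starRingEnd ℂ) (𝓕 G ξ) = 𝓕 (fun x => (starRingEnd ℂ) (G (-x))) ξ := by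
  rw [Real.fourier_eq, Real.fourier_eq, ← integral_conj, ← integral_neg_eq_self]
  congr 1; ext x
  simp only [Circle.smul_def, smul_eq_mul, map_mul, inner_neg_left, neg_neg]
  congr 1
  rw [AddChar.map_neg_eq_inv, Circle.coe_inv_eq_conj]

lemma fourier_bdd (F : EE d → ℂ) (ξ : EE d) : ‖𝓕 F ξ‖ ≤ ∫ x, ‖F x‖ := by
  exact VectorFourier.norm_fourierIntegral_le_integral_norm _ _ _ _ _

lemma bil_integrable (m : EE d → ℂ) (hm : Integrable m) (F G : EE d → ℂ)
    (hF : Integrable F) (hG : Integrable G) :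
    Integrable (fun ξ => m ξ * (𝓕 F ξ * (starRingEnd ℂ) (𝓕 G ξ))) := by
  have h1 := fourier_cont F hF
  have h2 := fourier_cont G hG
  have hc : Continuous (fun ξ => 𝓕 F ξ * (starRingEnd ℂ) (𝓕 G ξ)) := by fun_prop
  refine hm.mul_bdd (c := (∫ x, ‖F x‖) * ∫ x, ‖G x‖) hc.aestronglyMeasurable
    (Filter.Eventually.of_forall fun x => ?_)
  rw [norm_mul, RCLike.norm_conj]
  exact mul_le_mul (fourier_bdd F x) (fourier_bdd G x) (norm_nonneg _)
    (integral_nonneg fun _ => norm_nonneg _)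

lemma fourier_addE (F G : EE d → ℂ) (hF : Integrable F) (hG : Integrable G) (ξ : EE d) :
    𝓕 (F + G) ξ = 𝓕 F ξ + 𝓕 G ξ := by
  have := VectorFourier.fourierIntegral_add (e := Real.fourierChar)
    (μ := (volume : Measure (EE d))) (L := innerₗ (EE d)) Real.continuous_fourierChar
    continuous_inner hF hG
  exact congrFun this ξ

lemma bil_add_left (m : EE d → ℂ) (hm : Integrable m) (F F' G : EE d → ℂ)
    (hF : Integrable F) (hF' : Integrable F') (hG : Integrable G) :
    bil m (F + F') G = bil m F G + bil m F' G := by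
  unfold bil
  rw [← integral_add (bil_integrable m hm F G hF hG) (bil_integrable m hm F' G hF' hG)]
  congr 1; ext ξ
  rw [fourier_addE F F' hF hF']; ring

lemma bil_add_right (m : EE d → ℂ) (hm : Integrable m) (F G G' : EE d → ℂ)
    (hF : Integrable F) (hG : Integrable G) (hG' : Integrable G') :
    bil m F (G + G') = bil m F G + bil m F G' := by
  unfold bil
  rw [← integral_add (bil_integrable m hm F G hF hG) (bil_integrable m hm F G' hF hG')]
  congr 1; ext ξ
  rw [fourier_addE G G' hG hG', map_add]; ring

lemma SAdm.memLp2 {F : EE d → ℂ} (hF : SAdm volume F) : MemLp F 2 := by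
  obtain ⟨h1, h2, M, h3⟩ := hF
  rw [memLp_two_iff_integrable_sq_norm h1.aestronglyMeasurable]
  have := h2.norm.bdd_mul (c := M) h1.norm.aestronglyMeasurable
    (Filter.Eventually.of_forall fun x => by simpa using h3 x)
  simpa [sq] using this

lemma bil_L2 (m : EE d → ℂ) (A : ℝ) (hA : ∀ ξ, ‖m ξ‖ ≤ A) (F G : EE d → ℂ)
    (hF : SAdm volume F) (hG : SAdm volume G) :
    ‖bil m F G‖ₑ ≤ ENNReal.ofReal A *
      ((∫⁻ x, ENNReal.ofReal (‖F x‖^2))^(1/2:ℝ) * (∫⁻ x, ENNReal.ofReal (‖G x‖^2))^(1/2:ℝ)) := by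
  have hA0 : 0 ≤ A := (norm_nonneg _).trans (hA 0)
  have h1 := fourier_cont F hF.2.1
  have h2 := fourier_cont G hG.2.1
  calc ‖bil m F G‖ₑ ≤ ∫⁻ ξ, ‖m ξ * (𝓕 F ξ * (starRingEnd ℂ) (𝓕 G ξ))‖ₑ :=
        enorm_integral_le_lintegral_enorm _
    _ ≤ ∫⁻ ξ, ENNReal.ofReal A * (‖𝓕 F ξ‖ₑ * ‖𝓕 G ξ‖ₑ) := by
        apply lintegral_mono; intro ξ
        simp only [enorm_mul]
        gcongr
        · rw [← ofReal_norm]; exact ENNReal.ofReal_le_ofReal (hA ξ)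
        · rw [← ofReal_norm, ← ofReal_norm, RCLike.norm_conj]
    _ = ENNReal.ofReal A * ∫⁻ ξ, ‖𝓕 F ξ‖ₑ * ‖𝓕 G ξ‖ₑ := by
        rw [lintegral_const_mul' _ _ ENNReal.ofReal_ne_top]
    _ ≤ _ := by
        gcongr
        have := ENNReal.lintegral_mul_le_Lp_mul_Lq (volume : Measure (EE d))
          (p := 2) (q := 2) Real.HolderConjugate.two_two
          (f := fun ξ => ‖𝓕 F ξ‖ₑ) (g := fun ξ => ‖𝓕 G ξ‖ₑ)
          h1.enorm.aemeasurable h2.enorm.aemeasurable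
        refine this.trans (le_of_eq ?_)
        rw [← bessel F hF.2.1 hF.memLp2, ← bessel G hG.2.1 hG.memLp2]
        have e : ∀ z : ℂ, ENNReal.ofReal (‖z‖ ^ 2) = ‖z‖ₑ ^ (2:ℝ) := by
          intro z
          rw [ENNReal.ofReal_pow (norm_nonneg _), ofReal_norm]
          simp
        simp_rw [e]

lemma bil_L1 (m : EE d → ℂ) (hm : Integrable m) (D : ℝ) (hD : ∀ ξ, ‖𝓕 m ξ‖ ≤ D) (F G : EE d → ℂ)
    (hF : SAdm volume F) (hG : SAdm volume G) :
    ‖bil m F G‖ₑ ≤ ENNReal.ofReal D *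
      ((∫⁻ x, ENNReal.ofReal ‖F x‖) * (∫⁻ x, ENNReal.ofReal ‖G x‖)) := by
  have hD0 : 0 ≤ D := (norm_nonneg _).trans (hD 0)
  set P : EE d → ℂ := fun x => (starRingEnd ℂ) (G (-x)) with hP
  have hPi : Integrable P := by
    have : Integrable (fun x => G (-x)) := hG.2.1.comp_neg
    refine (integrable_norm_iff ?_).1 ?_
    · exact Complex.continuous_conj.comp_aestronglyMeasurable this.aestronglyMeasurable
    · simpa [hP] using this.norm
  have hPn : ∫ x, ‖P x‖ = ∫ x, ‖G x‖ := by
    simp only [hP, RCLike.norm_conj]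
    exact integral_neg_eq_self (fun x => ‖G x‖) volume
  have hQi : Integrable (fun ξ => 𝓕 P ξ * m ξ) :=
    hm.bdd_mul (c := ∫ x, ‖P x‖) (fourier_cont P hPi).aestronglyMeasurable
      (Filter.Eventually.of_forall fun x => fourier_bdd P x)
  have e : bil m F G = ∫ x, F x * 𝓕 (fun ξ => 𝓕 P ξ * m ξ) x := by
    rw [← fourier_flip F _ hF.2.1 hQi]
    unfold bil
    congr 1; ext ξ
    rw [fourier_conj]; ring
  have hb : ‖bil m F G‖ ≤ D * ((∫ x, ‖F x‖) * ∫ x, ‖G x‖) := by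
    rw [e]
    calc _ ≤ ∫ x, (D * ∫ x, ‖G x‖) * ‖F x‖ := by
          apply norm_integral_le_of_norm_le (hF.2.1.norm.const_mul _)
          refine Filter.Eventually.of_forall fun x => ?_
          rw [norm_mul, mul_comm, ← hPn]
          exact mul_le_mul_of_nonneg_right (fourier_mul_bound P m hPi hm D hD x) (norm_nonneg _)
      _ = _ := by rw [integral_const_mul]; ring
  rw [← ofReal_norm, ← ofReal_integral_eq_lintegral_ofReal hF.2.1.norm (Filter.Eventually.of_forall fun _ => norm_nonneg _), ← ofReal_integral_eq_lintegral_ofReal hG.2.1.norm (Filter.Eventually.of_forall fun _ => norm_nonneg _), ← ENNReal.ofReal_mul (integral_nonneg fun _ => norm_nonneg _), ← ENNReal.ofReal_mul hD0]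
  exact ENNReal.ofReal_le_ofReal hb

lemma bil_interp (p : ℝ) (hp1 : 1 < p) (hp2 : p < 2) (m : EE d → ℂ) (hm : Integrable m)
    (A D : ℝ) (hA0 : 0 < A) (hD0 : 0 < D)
    (hA : ∀ ξ, ‖m ξ‖ ≤ A) (hD : ∀ ξ, ‖𝓕 m ξ‖ ≤ D)
    (F G : EE d → ℂ) (hF : SAdm volume F) (hG : SAdm volume G) :
    ‖bil m F G‖ₑ ≤ ENNReal.ofReal ((2 ^ (2 - p) + (1 - 2 ^ (-(2 - p)))⁻¹ + 1) *
      (A ^ (2 - 2/p) * D ^ (2/p - 1) *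
        ((∫ x, ‖F x‖ ^ p) ^ (1/p) * (∫ x, ‖G x‖ ^ p) ^ (1/p)))) :=
  interp2 volume p hp1 hp2 (bil m) A D hA0 hD0
    (fun F F' G hF hF' hG => bil_add_left m hm F F' G hF.2.1 hF'.2.1 hG.2.1)
    (fun F G G' hF hG hG' => bil_add_right m hm F G G' hF.2.1 hG.2.1 hG'.2.1)
    (fun F G hF hG => bil_L2 m A hA F G hF hG)
    (fun F G hF hG => bil_L1 m hm D hD F G hF hG) F G hF hG


lemma tt_int {β : Type*} [MeasurableSpace β] (ρ : Measure β) [IsFiniteMeasure ρ]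
    (W : EE d × β → ℂ) (hW : StronglyMeasurable W) (c R : ℝ) (hc : ∀ p, ‖W p‖ ≤ c)
    (hs : ∀ p, R < ‖p.1‖ → W p = 0) : Integrable W (volume.prod ρ) := by
  have h1 : Integrable ((closedBall (0 : EE d) R).indicator (fun _ => c)) volume := by
    rw [integrable_indicator_iff measurableSet_closedBall]
    apply integrableOn_const (measure_closedBall_lt_top).ne
  have h2 := h1.comp_fst ρ
  refine h2.mono' hW.aestronglyMeasurable (Filter.Eventually.of_forall fun p => ?_)
  by_cases h : ‖p.1‖ ≤ R
  · rw [Set.indicator_of_mem (by simpa using h)]; exact hc p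
  · rw [hs p (not_le.1 h)]
    simp only [norm_zero]
    apply Set.indicator_nonneg
    intro _ _
    exact (norm_nonneg _).trans (hc p)

lemma tt_H (ν : Measure ℝ) [IsFiniteMeasure ν] (N : ℝ → EE d → ℂ)
    (hN : StronglyMeasurable (fun p : EE d × ℝ => N p.2 p.1)) (c R : ℝ)
    (hc : ∀ t ξ, ‖N t ξ‖ ≤ c) (hs : ∀ t ξ, R < ‖ξ‖ → N t ξ = 0) :
    ∫⁻ ξ, ‖∫ t, N t ξ ∂ν‖ₑ ^ (2:ℝ) ≤
      ∫⁻ t, ∫⁻ s, ‖∫ ξ, N t ξ * (starRingEnd ℂ) (N s ξ)‖ₑ ∂ν ∂ν := by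
  have hc0 : 0 ≤ c := (norm_nonneg _).trans (hc 0 0)
  set H : EE d → ℂ := fun ξ => ∫ t, N t ξ ∂ν with hH
  have hHm : StronglyMeasurable H := hN.integral_prod_right
  let W : EE d × (ℝ × ℝ) → ℂ := fun p => N p.2.1 p.1 * (starRingEnd ℂ) (N p.2.2 p.1)
  have hWm : StronglyMeasurable W := by
    apply StronglyMeasurable.mul
    · exact hN.comp_measurable (g := fun p : EE d × (ℝ × ℝ) => (p.1, p.2.1)) (by fun_prop)
    · exact Complex.continuous_conj.comp_stronglyMeasurable
        (hN.comp_measurable (g := fun p : EE d × (ℝ × ℝ) => (p.1, p.2.2)) (by fun_prop))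
  have hWi : Integrable W (volume.prod (ν.prod ν)) := by
    apply tt_int (ν.prod ν) W hWm (c * c) R
    · intro p
      simp only [W, norm_mul, RCLike.norm_conj]
      exact mul_le_mul (hc _ _) (hc _ _) (norm_nonneg _) hc0
    · intro p hp
      simp only [W, hs _ _ hp, zero_mul]
  have e1 : ∀ ξ, H ξ * (starRingEnd ℂ) (H ξ) = ∫ p, W (ξ, p) ∂(ν.prod ν) := by
    intro ξ
    simp only [hH, W]
    rw [← integral_conj, ← integral_prod_mul]
  have e2 : ∫ ξ, H ξ * (starRingEnd ℂ) (H ξ) = ∫ p, (∫ ξ, W (ξ, p)) ∂(ν.prod ν) := by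
    simp_rw [e1]
    exact integral_integral_swap (f := fun ξ p => W (ξ, p)) hWi
  have hHi : Integrable (fun ξ => H ξ * (starRingEnd ℂ) (H ξ)) := by
    simp_rw [e1]
    exact hWi.integral_prod_left
  have e3 : ∫⁻ ξ, ‖H ξ‖ₑ ^ (2:ℝ) = ‖∫ ξ, H ξ * (starRingEnd ℂ) (H ξ)‖ₑ := by
    have h1 : ∀ ξ, H ξ * (starRingEnd ℂ) (H ξ) = ((‖H ξ‖ ^ 2 : ℝ) : ℂ) := by
      intro ξ; rw [Complex.mul_conj, Complex.normSq_eq_norm_sq]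
    have h2 : Integrable (fun ξ => ‖H ξ‖ ^ 2) := by
      have := hHi.norm
      simpa [h1] using this
    simp_rw [h1]
    rw [integral_complex_ofReal, ← ofReal_norm, Complex.norm_real, Real.norm_of_nonneg (integral_nonneg fun _ => by positivity),
      ofReal_integral_eq_lintegral_ofReal h2 (Filter.Eventually.of_forall fun _ => by positivity)]
    congr 1; ext ξ
    rw [ENNReal.ofReal_pow (norm_nonneg _), ofReal_norm]
    simp
  rw [e3, e2]
  refine (enorm_integral_le_lintegral_enorm _).trans ?_
  rw [lintegral_prod]
  have : StronglyMeasurable (fun p : ℝ × ℝ => ∫ ξ, W (ξ, p)) := hWm.integral_prod_left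
  exact this.enorm.aemeasurable

lemma tt_pair (ν : Measure ℝ) [IsFiniteMeasure ν] (N : ℝ → EE d → ℂ)
    (hN : StronglyMeasurable (fun p : EE d × ℝ => N p.2 p.1)) (c : ℝ)
    (hc : ∀ t ξ, ‖N t ξ‖ ≤ c) (φ : EE d → ℂ) (hφ : Integrable φ) :
    ‖∫ t, (∫ ξ, φ ξ * (starRingEnd ℂ) (N t ξ)) ∂ν‖ₑ ≤
      (∫⁻ ξ, ‖φ ξ‖ₑ ^ (2:ℝ)) ^ (1/2:ℝ) * (∫⁻ ξ, ‖∫ t, N t ξ ∂ν‖ₑ ^ (2:ℝ)) ^ (1/2:ℝ) := by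
  set H : EE d → ℂ := fun ξ => ∫ t, N t ξ ∂ν with hH
  have hHm : StronglyMeasurable H := hN.integral_prod_right
  have hi : Integrable (fun p : EE d × ℝ => φ p.1 * (starRingEnd ℂ) (N p.2 p.1)) (volume.prod ν) := by
    refine (hφ.comp_fst ν).mul_bdd (c := c) ?_ ?_
    · exact (Complex.continuous_conj.comp_stronglyMeasurable hN).aestronglyMeasurable
    · exact Filter.Eventually.of_forall fun p => by simpa using hc _ _
  have e : ∫ t, (∫ ξ, φ ξ * (starRingEnd ℂ) (N t ξ)) ∂ν = ∫ ξ, φ ξ * (starRingEnd ℂ) (H ξ) := by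
    rw [← integral_integral_swap (f := fun ξ t => φ ξ * (starRingEnd ℂ) (N t ξ)) hi]
    congr 1; ext ξ
    rw [integral_const_mul, integral_conj]
  rw [e]
  refine (enorm_integral_le_lintegral_enorm _).trans ?_
  have := ENNReal.lintegral_mul_le_Lp_mul_Lq (volume : Measure (EE d))
          (p := 2) (q := 2) Real.HolderConjugate.two_two
          (f := fun ξ => ‖φ ξ‖ₑ) (g := fun ξ => ‖H ξ‖ₑ)
          hφ.aestronglyMeasurable.enorm hHm.enorm.aemeasurable
  refine le_trans (le_of_eq ?_) this
  congr 1; ext ξ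
  simp only [Pi.mul_apply, enorm_mul]
  rw [← ofReal_norm ((starRingEnd ℂ) (H ξ)), RCLike.norm_conj, ofReal_norm]


lemma fourier_joint_meas (F : ℝ → EE d → ℂ)
    (hF : StronglyMeasurable (fun p : EE d × ℝ => F p.2 p.1)) :
    StronglyMeasurable (fun p : EE d × ℝ => 𝓕 (F p.2) p.1) := by
  have : (fun p : EE d × ℝ => 𝓕 (F p.2) p.1) =
      fun p : EE d × ℝ => ∫ x, (Real.fourierChar (-⟪x, p.1⟫) : ℂ) * F p.2 x := by
    ext p; rw [Real.fourier_eq]; rfl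
  rw [this]
  apply StronglyMeasurable.integral_prod_right
    (f := fun (p : EE d × ℝ) (x : EE d) => (Real.fourierChar (-⟪x, p.1⟫) : ℂ) * F p.2 x)
  apply StronglyMeasurable.mul
  · have h := Real.continuous_fourierChar
    have : Continuous (fun q : (EE d × ℝ) × EE d => (Real.fourierChar (-⟪q.2, q.1.1⟫) : ℂ)) := by
      fun_prop
    exact this.stronglyMeasurable
  · exact hF.comp_measurable (g := fun q : (EE d × ℝ) × EE d => (q.2, q.1.2)) (by fun_prop)

/-- the extension operator -/
def Uop (M : ℝ → EE d → ℂ) (φ : EE d → ℂ) (t : ℝ) (x : EE d) : ℂ :=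
  𝓕 (fun ξ => M t ξ * φ ξ) (-x)

lemma tt_fin (γ : ℝ) (hγ0 : 0 < γ) (hγ1 : γ < 1) (M : ℝ → EE d → ℂ)
    (hM : Continuous (fun p : EE d × ℝ => M p.2 p.1)) (B R0 : ℝ) (hB : ∀ t ξ, ‖M t ξ‖ ≤ B)
    (hR0 : ∀ t ξ, R0 < ‖ξ‖ → M t ξ = 0) (φ : EE d → ℂ) (hφc : Continuous φ) (hφ : Integrable φ)
    (K : ℝ) (hK0 : 0 < K)
    (hK : ∀ t ∈ Icc (1:ℝ) 2, ∀ s ∈ Icc (1:ℝ) 2, t ≠ s → ∀ F G, SAdm volume F → SAdm volume G →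
      ‖bil (fun ξ => (starRingEnd ℂ) (M t ξ) * M s ξ) F G‖ₑ ≤ ENNReal.ofReal (K * |t - s| ^ (-γ) *
        ((∫ x, ‖F x‖ ^ (2/(2-γ))) ^ (1 - γ/2) * (∫ x, ‖G x‖ ^ (2/(2-γ))) ^ (1 - γ/2)))) (R : ℝ) :
    (∫⁻ t in Icc (1:ℝ) 2, ∫⁻ x in closedBall (0 : EE d) R, ‖Uop M φ t x‖ₑ ^ (2/γ)) ^ (γ/2) ≤
      ENNReal.ofReal ((K * (1 + 4/(1-γ) + 8/γ)) ^ (1/2:ℝ)) * (∫⁻ ξ, ‖φ ξ‖ₑ ^ (2:ℝ)) ^ (1/2:ℝ) := by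
  set ν : Measure ℝ := volume.restrict (Icc (1:ℝ) 2) with hν
  have : IsFiniteMeasure ν := by
    rw [hν]; infer_instance
  have hB0 : 0 ≤ B := (norm_nonneg _).trans (hB 0 0)
  set q : ℝ := 2 / γ with hq
  have hq2 : 2 < q := by rw [hq, lt_div_iff₀ hγ0]; linarith
  set p : ℝ := 2 / (2 - γ) with hp
  have hpq : (q - 1) * p = q := by
    have h2 : 2 - γ ≠ 0 := by linarith
    rw [hq, hp]; field_simp
  set U := Uop M φ with hU
  have hUm : StronglyMeasurable (fun p : EE d × ℝ => U p.2 p.1) := by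
    have h1 := fourier_joint_meas (fun t ξ => M t ξ * φ ξ)
      (hM.mul (hφc.comp continuous_fst)).stronglyMeasurable
    exact h1.comp_measurable (g := fun p : EE d × ℝ => (-p.1, p.2)) (by fun_prop)
  have hMφ : ∀ t, Integrable (fun ξ => M t ξ * φ ξ) := by
    intro t
    have : Continuous (fun ξ => M t ξ) := hM.comp (Continuous.prodMk continuous_id continuous_const)
    exact hφ.bdd_mul (c := B) this.aestronglyMeasurable
      (Filter.Eventually.of_forall fun x => hB t x)
  set BU : ℝ := B * ∫ ξ, ‖φ ξ‖ with hBU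
  have hBU0 : 0 ≤ BU := mul_nonneg hB0 (integral_nonneg fun _ => norm_nonneg _)
  have hUb : ∀ t x, ‖U t x‖ ≤ BU := by
    intro t x
    refine (fourier_bdd _ _).trans ?_
    rw [hBU, ← integral_const_mul]
    apply integral_mono (hMφ t).norm (hφ.norm.const_mul _)
    intro ξ
    simp only [norm_mul]
    exact mul_le_mul_of_nonneg_right (hB t ξ) (norm_nonneg _)
  -- dual function
  let F : ℝ → EE d → ℂ := fun t =>
    (closedBall (0 : EE d) R).indicator (fun x => ((‖U t x‖ ^ (q - 2) : ℝ) : ℂ) * U t x)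
  have hFm : StronglyMeasurable (fun p : EE d × ℝ => F p.2 p.1) := by
    have h1 : StronglyMeasurable (fun p : EE d × ℝ => ((‖U p.2 p.1‖ ^ (q - 2) : ℝ) : ℂ) * U p.2 p.1) := by
      have h2 : Measurable (fun p : EE d × ℝ => U p.2 p.1) := hUm.measurable
      exact ((Complex.measurable_ofReal.comp (h2.norm.pow_const (q - 2))).mul h2).stronglyMeasurable
    have h2 := h1.indicator (s := Prod.fst ⁻¹' (closedBall (0 : EE d) R))
      (measurable_fst measurableSet_closedBall)
    convert! h2 using 1
  have hFn : ∀ t x, ‖F t x‖ = (closedBall (0 : EE d) R).indicator (fun x => ‖U t x‖ ^ (q - 1)) x := by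
    intro t x
    by_cases h : x ∈ closedBall (0 : EE d) R
    · simp only [F, Set.indicator_of_mem h, norm_mul, Complex.norm_real]
      rw [Real.norm_of_nonneg (by positivity), ← Real.rpow_add_one' (norm_nonneg _) (by linarith)]
      congr 1; ring
    · simp only [F, Set.indicator_of_notMem h, norm_zero]
  have hFb : ∀ t x, ‖F t x‖ ≤ BU ^ (q - 1) := by
    intro t x
    rw [hFn]
    refine Set.indicator_le' (f := fun x => ‖U t x‖ ^ (q - 1)) (g := fun _ => BU ^ (q-1)) ?_ ?_ x
    · intro x _
      exact Real.rpow_le_rpow (norm_nonneg _) (hUb t x) (by linarith)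
    · intro x _; positivity
  have hone : Integrable ((closedBall (0 : EE d) R).indicator (fun _ => BU ^ (q-1))) volume := by
    rw [integrable_indicator_iff measurableSet_closedBall]
    apply integrableOn_const (measure_closedBall_lt_top).ne
  have hFb2 : ∀ t x, ‖F t x‖ ≤ (closedBall (0 : EE d) R).indicator (fun _ => BU ^ (q-1)) x := by
    intro t x
    by_cases h : x ∈ closedBall (0 : EE d) R
    · rw [Set.indicator_of_mem h]; exact hFb t x
    · rw [hFn, Set.indicator_of_notMem h, Set.indicator_of_notMem h]
  have hFmt : ∀ t, Measurable (F t) := fun t =>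
    (hFm.comp_measurable (g := fun x : EE d => (x, t)) (by fun_prop)).measurable
  have hFi : ∀ t, Integrable (F t) := fun t =>
    hone.mono' (hFmt t).aestronglyMeasurable (Filter.Eventually.of_forall (hFb2 t))
  have hFS : ∀ t, SAdm volume (F t) := fun t => ⟨hFmt t, hFi t, _, hFb t⟩
  let N : ℝ → EE d → ℂ := fun t ξ => (starRingEnd ℂ) (M t ξ) * 𝓕 (F t) ξ
  set L : ℝ := ∫ x, (closedBall (0 : EE d) R).indicator (fun _ => BU ^ (q-1)) x with hL
  have hFh : ∀ t ξ, ‖𝓕 (F t) ξ‖ ≤ L := by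
    intro t ξ
    exact (fourier_bdd _ _).trans (integral_mono (hFi t).norm hone (hFb2 t))
  have hNm : StronglyMeasurable (fun p : EE d × ℝ => N p.2 p.1) := by
    apply StronglyMeasurable.mul
    · exact (Complex.continuous_conj.comp hM).stronglyMeasurable
    · exact fourier_joint_meas F hFm
  have hNb : ∀ t ξ, ‖N t ξ‖ ≤ B * L := by
    intro t ξ
    simp only [N, norm_mul, RCLike.norm_conj]
    exact mul_le_mul (hB t ξ) (hFh t ξ) (norm_nonneg _) hB0
  have hNs : ∀ t ξ, R0 < ‖ξ‖ → N t ξ = 0 := by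
    intro t ξ h; simp only [N, hR0 t ξ h, map_zero, zero_mul]
  -- the quantity u
  let u : ℝ → ℝ := fun t => ∫ x, ‖F t x‖ ^ p
  have hu0 : ∀ t, 0 ≤ u t := fun t => integral_nonneg fun x => by positivity
  have hFp : ∀ t x, ‖F t x‖ ^ p = (closedBall (0 : EE d) R).indicator (fun x => ‖U t x‖ ^ q) x := by
    intro t x
    rw [hFn]
    by_cases h : x ∈ closedBall (0 : EE d) R
    · rw [Set.indicator_of_mem h, Set.indicator_of_mem h, ← Real.rpow_mul (norm_nonneg _), hpq]
    · rw [Set.indicator_of_notMem h, Set.indicator_of_notMem h, Real.zero_rpow]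
      rw [hp]; apply ne_of_gt; apply div_pos <;> linarith
  have hum : Measurable u := by
    have : StronglyMeasurable (fun p' : EE d × ℝ => ‖F p'.2 p'.1‖ ^ p) := by
      have h2 : Measurable (fun p : EE d × ℝ => F p.2 p.1) := hFm.measurable
      exact (h2.norm.pow_const p).stronglyMeasurable
    exact this.integral_prod_left.measurable
  have hup : ∀ t, ENNReal.ofReal (u t) = ∫⁻ x in closedBall (0 : EE d) R, ‖U t x‖ₑ ^ q := by
    intro t
    have hi : Integrable (fun x => ‖F t x‖ ^ p) := by
      have h1 : Integrable ((closedBall (0 : EE d) R).indicator (fun _ => BU ^ q)) volume := by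
        rw [integrable_indicator_iff measurableSet_closedBall]
        apply integrableOn_const (measure_closedBall_lt_top).ne
      refine h1.mono' ?_ (Filter.Eventually.of_forall fun x => ?_)
      · have := hFmt t
        apply Measurable.aestronglyMeasurable
        fun_prop
      · rw [Real.norm_of_nonneg (by positivity), hFp]
        apply Set.indicator_le_indicator
        exact Real.rpow_le_rpow (norm_nonneg _) (hUb t x) (by linarith)
    rw [ofReal_integral_eq_lintegral_ofReal hi (Filter.Eventually.of_forall fun _ => by positivity),
      ← lintegral_indicator measurableSet_closedBall]
    congr 1; ext x
    rw [hFp]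
    by_cases h : x ∈ closedBall (0 : EE d) R
    · rw [Set.indicator_of_mem h, Set.indicator_of_mem h,
        ← ENNReal.ofReal_rpow_of_nonneg (norm_nonneg _) (by linarith), ofReal_norm]
    · rw [Set.indicator_of_notMem h, Set.indicator_of_notMem h, ENNReal.ofReal_zero]
  have huN : ∀ t, ∫ ξ, φ ξ * (starRingEnd ℂ) (N t ξ) = (u t : ℂ) := by
    intro t
    set P : EE d → ℂ := fun x => (starRingEnd ℂ) (F t (-x)) with hP
    have hPi : Integrable P := by
      have : Integrable (fun x => F t (-x)) := (hFi t).comp_neg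
      refine (integrable_norm_iff ?_).1 ?_
      · exact Complex.continuous_conj.comp_aestronglyMeasurable this.aestronglyMeasurable
      · simpa [hP] using this.norm
    have h1 := fourier_flip P _ hPi (hMφ t)
    have h2 : ∫ ξ, φ ξ * (starRingEnd ℂ) (N t ξ) = ∫ ξ, 𝓕 P ξ * (M t ξ * φ ξ) := by
      congr 1; ext ξ
      simp only [N, map_mul, Complex.conj_conj]
      rw [fourier_conj]; ring
    rw [h2, h1, ← integral_neg_eq_self, ← integral_complex_ofReal]
    congr 1; ext x
    simp only [hP, neg_neg]
    rw [hFp]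
    change (starRingEnd ℂ) (F t x) * U t x = _
    by_cases h : x ∈ closedBall (0 : EE d) R
    · simp only [F, Set.indicator_of_mem h, map_mul, Complex.conj_ofReal]
      rw [mul_assoc, mul_comm ((starRingEnd ℂ) (U t x)), Complex.mul_conj, Complex.normSq_eq_norm_sq,
        ← Complex.ofReal_mul]
      congr 1
      rw [← Real.rpow_natCast, ← Real.rpow_add' (norm_nonneg _) (by push_cast; linarith)]
      congr 1; push_cast; ring
    · simp only [F, Set.indicator_of_notMem h, map_zero, zero_mul, Complex.ofReal_zero]
  have hub : ∀ t, u t ≤ BU * L := by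
    intro t
    have h1 : (u t : ℂ) = ∫ ξ, φ ξ * (starRingEnd ℂ) (N t ξ) := (huN t).symm
    have h2 : u t ≤ ‖∫ ξ, φ ξ * (starRingEnd ℂ) (N t ξ)‖ := by
      rw [← h1, Complex.norm_real]; exact le_abs_self _
    refine h2.trans ?_
    calc _ ≤ ∫ ξ, ‖φ ξ‖ * (B * L) := by
          apply norm_integral_le_of_norm_le (hφ.norm.mul_const _)
          refine Filter.Eventually.of_forall fun ξ => ?_
          rw [norm_mul, RCLike.norm_conj]
          exact mul_le_mul_of_nonneg_left (hNb t ξ) (norm_nonneg _)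
      _ = _ := by rw [integral_mul_const, hBU]; ring
  have hui : Integrable u ν := by
    refine Integrable.of_bound hum.aestronglyMeasurable (BU * L) (Filter.Eventually.of_forall fun t => ?_)
    rw [Real.norm_of_nonneg (hu0 t)]; exact hub t
  set V : ℝ := ∫ t, u t ∂ν with hV
  have hV0 : 0 ≤ V := integral_nonneg hu0
  have hVe : ∫⁻ t, ENNReal.ofReal (u t) ∂ν = ENNReal.ofReal V := by
    rw [hV, ofReal_integral_eq_lintegral_ofReal hui (Filter.Eventually.of_forall hu0)]
  have hgoal : ∫⁻ t in Icc (1:ℝ) 2, ∫⁻ x in closedBall (0 : EE d) R, ‖U t x‖ₑ ^ q = ENNReal.ofReal V := by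
    rw [← hVe]; simp_rw [hup]; rfl
  rw [hgoal]
  rcases hV0.eq_or_lt with hV0 | hVpos
  · rw [← hV0, ENNReal.ofReal_zero, ENNReal.zero_rpow_of_pos (by positivity)]; exact zero_le
  have hpair := tt_pair ν N hNm (B * L) hNb φ hφ
  simp_rw [huN] at hpair
  rw [integral_complex_ofReal, ← ofReal_norm, Complex.norm_real, Real.norm_of_nonneg hV0] at hpair
  have hH := tt_H ν N hNm (B * L) R0 hNb hNs
  set c : ℝ := 1 + 4/(1-γ) + 8/γ with hc
  have hc0 : 0 < c := by
    have : 0 < 1 - γ := by linarith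
    positivity
  have hb : ∫⁻ t, ∫⁻ s, ‖∫ ξ, N t ξ * (starRingEnd ℂ) (N s ξ)‖ₑ ∂ν ∂ν ≤
      ENNReal.ofReal (K * c * V ^ (2 - γ)) := by
    have hh := hls γ hγ0 hγ1 (Icc 1 2) u hum hu0 V hVpos hVe.le
    calc _ ≤ ∫⁻ t, ∫⁻ s, ENNReal.ofReal K * ENNReal.ofReal (u t ^ (1 - γ/2) * u s ^ (1 - γ/2) * |t - s| ^ (-γ)) ∂ν ∂ν := by
          apply lintegral_mono_ae
          filter_upwards [ae_restrict_mem measurableSet_Icc] with t ht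
          apply lintegral_mono_ae
          have hne : ∀ᵐ s ∂ν, s ≠ t := by
            rw [hν]; exact ae_restrict_of_ae (Measure.ae_ne volume t)
          filter_upwards [ae_restrict_mem measurableSet_Icc, hne] with s hs hst
          have := hK t ht s hs hst.symm (F t) (F s) (hFS t) (hFS s)
          rw [← ENNReal.ofReal_mul hK0.le]
          refine le_trans (le_of_eq ?_) (this.trans (le_of_eq ?_))
          · congr 1
            unfold bil
            congr 1; ext ξ
            simp only [N, map_mul, Complex.conj_conj]; ring
          · congr 1
            simp only [u, hp]; ring
      _ = ENNReal.ofReal K * ∫⁻ t, ∫⁻ s, ENNReal.ofReal (u t ^ (1 - γ/2) * u s ^ (1 - γ/2) * |t - s| ^ (-γ)) ∂ν ∂ν := by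
          simp_rw [lintegral_const_mul' _ _ ENNReal.ofReal_ne_top]
      _ ≤ ENNReal.ofReal K * ENNReal.ofReal (c * V ^ (2 - γ)) := by gcongr
      _ = _ := by rw [← ENNReal.ofReal_mul hK0.le, mul_assoc]
  have hfin : ENNReal.ofReal V ≤ (∫⁻ ξ, ‖φ ξ‖ₑ ^ (2:ℝ)) ^ (1/2:ℝ) *
      (ENNReal.ofReal ((K * c) ^ (1/2:ℝ)) * ENNReal.ofReal (V ^ (1 - γ/2))) := by
    refine hpair.trans ?_
    gcongr
    calc _ ≤ (ENNReal.ofReal (K * c * V ^ (2 - γ))) ^ (1/2:ℝ) := by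
          gcongr; exact hH.trans hb
      _ = _ := by
          rw [ENNReal.ofReal_rpow_of_nonneg (by positivity) (by norm_num), Real.mul_rpow (by positivity) (by positivity), ENNReal.ofReal_mul (by positivity), ← Real.rpow_mul hVpos.le]
          congr 3; ring
  have hsplit : ENNReal.ofReal V = ENNReal.ofReal V ^ (γ/2) * ENNReal.ofReal (V ^ (1 - γ/2)) := by
    rw [ENNReal.ofReal_rpow_of_pos hVpos, ← ENNReal.ofReal_mul (by positivity), ← Real.rpow_add hVpos]
    simp
  rw [hsplit, ← mul_assoc] at hfin
  have hx0 : ENNReal.ofReal (V ^ (1 - γ/2)) ≠ 0 := by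
    simp only [ne_eq, ENNReal.ofReal_eq_zero, not_le]; positivity
  have := (ENNReal.mul_le_mul_iff_left hx0 ENNReal.ofReal_ne_top).1 hfin
  rw [mul_comm (ENNReal.ofReal ((K * c) ^ (1/2:ℝ)))]
  exact this


lemma tt_all (γ : ℝ) (hγ0 : 0 < γ) (hγ1 : γ < 1) (M : ℝ → EE d → ℂ)
    (hM : Continuous (fun p : EE d × ℝ => M p.2 p.1)) (B R0 : ℝ) (hB : ∀ t ξ, ‖M t ξ‖ ≤ B)
    (hR0 : ∀ t ξ, R0 < ‖ξ‖ → M t ξ = 0) (φ : EE d → ℂ) (hφc : Continuous φ) (hφ : Integrable φ)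
    (K : ℝ) (hK0 : 0 < K)
    (hK : ∀ t ∈ Icc (1:ℝ) 2, ∀ s ∈ Icc (1:ℝ) 2, t ≠ s → ∀ F G, SAdm volume F → SAdm volume G →
      ‖bil (fun ξ => (starRingEnd ℂ) (M t ξ) * M s ξ) F G‖ₑ ≤ ENNReal.ofReal (K * |t - s| ^ (-γ) *
        ((∫ x, ‖F x‖ ^ (2/(2-γ))) ^ (1 - γ/2) * (∫ x, ‖G x‖ ^ (2/(2-γ))) ^ (1 - γ/2)))) :
    (∫⁻ x : EE d, ∫⁻ t in Icc (1:ℝ) 2, ‖Uop M φ t x‖ₑ ^ (2/γ)) ^ (γ/2) ≤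
      ENNReal.ofReal ((K * (1 + 4/(1-γ) + 8/γ)) ^ (1/2:ℝ)) * (∫⁻ ξ, ‖φ ξ‖ₑ ^ (2:ℝ)) ^ (1/2:ℝ) := by
  set Z := ENNReal.ofReal ((K * (1 + 4/(1-γ) + 8/γ)) ^ (1/2:ℝ)) * (∫⁻ ξ, ‖φ ξ‖ₑ ^ (2:ℝ)) ^ (1/2:ℝ)
  have hUm : StronglyMeasurable (fun p : EE d × ℝ => Uop M φ p.2 p.1) := by
    have h1 := fourier_joint_meas (fun t ξ => M t ξ * φ ξ)
      (hM.mul (hφc.comp continuous_fst)).stronglyMeasurable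
    exact h1.comp_measurable (g := fun p : EE d × ℝ => (-p.1, p.2)) (by fun_prop)
  have hm : Measurable (fun p : EE d × ℝ => ‖Uop M φ p.2 p.1‖ₑ ^ (2/γ)) :=
    hUm.measurable.enorm.pow_const _
  have hfin : ∀ n : ℕ, ∫⁻ x in closedBall (0 : EE d) n, ∫⁻ t in Icc (1:ℝ) 2, ‖Uop M φ t x‖ₑ ^ (2/γ)
      ≤ Z ^ (2/γ) := by
    intro n
    have h := tt_fin γ hγ0 hγ1 M hM B R0 hB hR0 φ hφc hφ K hK0 hK n
    rw [lintegral_lintegral_swap (f := fun x t => ‖Uop M φ t x‖ₑ ^ (2/γ)) hm.aemeasurable]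
    have h2 := ENNReal.rpow_le_rpow h (show 0 ≤ 2/γ by positivity)
    rw [← ENNReal.rpow_mul, show γ/2*(2/γ) = 1 by field_simp, ENNReal.rpow_one] at h2
    exact h2
  have hall : ∫⁻ x : EE d, ∫⁻ t in Icc (1:ℝ) 2, ‖Uop M φ t x‖ₑ ^ (2/γ) ≤ Z ^ (2/γ) := by
    have hun : (⋃ n : ℕ, closedBall (0 : EE d) n) = Set.univ := iUnion_closedBall_nat 0
    rw [← setLIntegral_univ, ← hun, setLIntegral_iUnion_of_directed]
    · exact iSup_le hfin
    · apply Monotone.directed_le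
      intro m n hmn
      exact closedBall_subset_closedBall (by exact_mod_cast hmn)
  have h2 := ENNReal.rpow_le_rpow hall (show 0 ≤ γ/2 by positivity)
  rw [← ENNReal.rpow_mul Z, show 2/γ*(γ/2) = 1 by field_simp, ENNReal.rpow_one] at h2
  exact h2


lemma radial_schwartz (β : ℝ → ℝ) (hβsm : ContDiff ℝ (⊤ : ℕ∞) β)
    (hβsupp : Function.support β ⊆ Ioo (1/2 : ℝ) 2) :
    ∃ S : SchwartzMap (EE d) ℂ, ∀ η, S η = ((β ‖η‖ : ℝ) : ℂ) := by
  have hz : ∀ r, r ∉ Ioo (1/2 : ℝ) 2 → β r = 0 := by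
    intro r hr
    by_contra h
    exact hr (hβsupp h)
  have h1 : ContDiff ℝ (⊤ : ℕ∞) (fun η : EE d => ((β ‖η‖ : ℝ) : ℂ)) := by
    apply Complex.ofRealCLM.contDiff.comp
    rw [contDiff_iff_contDiffAt]
    intro η
    by_cases hη : η = 0
    · subst hη
      have : (fun η : EE d => β ‖η‖) =ᶠ[nhds 0] fun _ => 0 := by
        filter_upwards [Metric.ball_mem_nhds (0 : EE d) (show (0:ℝ) < 1/2 by norm_num)] with η hη
        apply hz
        intro h
        have h2 : ‖η‖ < 1/2 := by simpa using hη
        exact absurd h.1 (not_lt.2 h2.le)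
      exact contDiffAt_const.congr_of_eventuallyEq this
    · exact hβsm.contDiffAt.comp η (contDiffAt_norm ℝ hη)
  have h2 : HasCompactSupport (fun η : EE d => ((β ‖η‖ : ℝ) : ℂ)) := by
    apply HasCompactSupport.intro (isCompact_closedBall (0 : EE d) 2)
    intro η hη
    have h3 : 2 < ‖η‖ := by simpa using hη
    rw [hz]; · simp
    intro h
    exact absurd h.2 (not_lt.2 h3.le)
  exact ⟨h2.toSchwartzMap h1, fun η => rfl⟩

lemma scale_L1 (ψ : EE d → ℂ) (hψ : Integrable ψ) (r : ℝ) (hr : 0 < r) :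
    ∃ P : EE d → ℂ, Integrable P ∧ ∫ x, ‖P x‖ = ∫ x, ‖ψ x‖ ∧ ∀ ξ, 𝓕 P ξ = 𝓕 ψ (r⁻¹ • ξ) := by
  set c : ℝ := r ^ (Module.finrank ℝ (EE d)) with hc
  have hc0 : 0 < c := by positivity
  refine ⟨fun x => (c : ℂ) * ψ (r • x), (hψ.comp_smul hr.ne').const_mul _, ?_, ?_⟩
  · simp only [norm_mul, Complex.norm_real, Real.norm_of_nonneg hc0.le]
    rw [integral_const_mul, Measure.integral_comp_smul volume (fun x => ‖ψ x‖) r, ← hc,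
      abs_of_nonneg (by positivity), smul_eq_mul, ← mul_assoc, mul_inv_cancel₀ hc0.ne', one_mul]
  · intro ξ
    rw [Real.fourier_eq, Real.fourier_eq]
    have h := Measure.integral_comp_smul (volume : Measure (EE d)) (fun v => Real.fourierChar (-⟪v, r⁻¹ • ξ⟫) • ψ v) r
    rw [← hc, abs_of_nonneg (by positivity)] at h
    have h2 : (∫ v, Real.fourierChar (-⟪v, r⁻¹ • ξ⟫) • ψ v) = (c : ℂ) * ∫ x : EE d, Real.fourierChar (-⟪r • x, r⁻¹ • ξ⟫) • ψ (r • x) := by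
      rw [h, Complex.real_smul, ← mul_assoc, ← Complex.ofReal_mul, mul_inv_cancel₀ hc0.ne']; simp
    rw [h2, ← integral_const_mul]
    congr 1; ext x
    rw [real_inner_smul_left, real_inner_smul_right, ← mul_assoc, mul_inv_cancel₀ hr.ne', one_mul]
    simp only [Circle.smul_def, smul_eq_mul]; ring

lemma exp_eq_char (r : ℝ) : Complex.exp (2 * (π : ℂ) * Complex.I * (r : ℂ)) = (Real.fourierChar r : ℂ) := by
  rw [Real.fourierChar_apply]; congr 1; push_cast; ring

lemma exp_eq_char' (r : ℝ) : Complex.exp (-(2 * (π : ℂ) * Complex.I * (r : ℂ))) = (Real.fourierChar (-r) : ℂ) := by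
  rw [← exp_eq_char]; congr 1; push_cast; ring

lemma mFT_cont (μ : Measure (EE d)) [IsFiniteMeasure μ] : Continuous (mFT μ) := by
  unfold mFT
  simp_rw [exp_eq_char']
  have h := Real.continuous_fourierChar
  apply continuous_of_dominated (bound := fun _ => 1)
  · intro ξ
    apply Continuous.aestronglyMeasurable; fun_prop
  · intro ξ; exact Filter.Eventually.of_forall fun x => (Circle.norm_coe _).le
  · exact integrable_const _
  · refine Filter.Eventually.of_forall fun x => ?_
    fun_prop

lemma mFT_bdd (μ : Measure (EE d)) [IsFiniteMeasure μ] (ξ : EE d) : ‖mFT μ ξ‖ ≤ μ.real univ := by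
  unfold mFT
  simp_rw [exp_eq_char']
  refine (norm_integral_le_of_norm_le (integrable_const (1:ℝ)) (Filter.Eventually.of_forall fun x => (Circle.norm_coe _).le)).trans ?_
  simp

/-- the multiplier -/
def Mult (μ : Measure (EE d)) (β : ℝ → ℝ) (j : ℕ) (t : ℝ) (ξ : EE d) : ℂ :=
  ((β ((2:ℝ) ^ (-(j:ℤ)) * ‖ξ‖) : ℝ) : ℂ) * mFT μ (t • ξ)

lemma rep (μ : Measure (EE d)) [IsFiniteMeasure μ] (β : ℝ → ℝ) (hβ : Continuous β) (Mb : ℝ)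
    (hMb : ∀ r, |β r| ≤ Mb) (j : ℕ) (f : EE d → ℂ) (hf : Integrable (𝓕 f)) (t : ℝ) (x : EE d) :
    convM (Pproj β (j:ℤ) f) μ t x = Uop (Mult μ β j) (𝓕 f) t x := by
  have hch := Real.continuous_fourierChar
  unfold convM Pproj Uop
  rw [Real.fourier_eq]
  simp_rw [exp_eq_char]
  set g : EE d → ℂ := fun ξ => ((β ((2:ℝ) ^ (-(j:ℤ)) * ‖ξ‖) : ℝ) : ℂ) * 𝓕 f ξ with hg
  have hgi : Integrable g := by
    apply hf.bdd_mul (c := Mb)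
    · apply Continuous.aestronglyMeasurable; fun_prop
    · exact Filter.Eventually.of_forall fun ξ => by simpa using hMb _
  rw [integral_integral_swap]
  · congr 1; ext ξ
    simp only [Mult, mFT, Circle.smul_def, smul_eq_mul]
    simp_rw [exp_eq_char']
    rw [← mul_assoc, integral_mul_const, integral_mul_const, mul_comm _ (∫ x, _ ∂μ), ← mul_assoc]
    congr 2
    rw [← integral_const_mul]
    congr 1; ext y
    have : (Real.fourierChar ⟪x - t • y, ξ⟫ : ℂ) = (Real.fourierChar (-⟪y, t • ξ⟫) : ℂ) * (Real.fourierChar (-⟪ξ, -x⟫) : ℂ) := by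
      rw [← Circle.coe_mul, ← AddChar.map_add_eq_mul]
      congr 2
      rw [inner_sub_left, real_inner_smul_left, real_inner_smul_right, inner_neg_right, real_inner_comm x ξ]; ring
    rw [this]
    ring
  · have h1 : Integrable (fun p : EE d × EE d => g p.2) (μ.prod volume) := hgi.comp_snd μ
    have h2 := h1.bdd_mul (c := 1) (f := fun p : EE d × EE d => (Real.fourierChar ⟪x - t • p.1, p.2⟫ : ℂ)) (by
      apply Continuous.aestronglyMeasurable; fun_prop) (Filter.Eventually.of_forall fun p => (Circle.norm_coe _).le)
    convert h2 using 1
    ext p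
    simp only [Function.uncurry, hg]; ring


lemma Mult_cont (μ : Measure (EE d)) [IsFiniteMeasure μ] (β : ℝ → ℝ) (hβ : Continuous β) (j : ℕ) :
    Continuous (fun p : EE d × ℝ => Mult μ β j p.2 p.1) := by
  have := mFT_cont μ
  unfold Mult
  fun_prop

lemma Mult_cont1 (μ : Measure (EE d)) [IsFiniteMeasure μ] (β : ℝ → ℝ) (hβ : Continuous β) (j : ℕ)
    (t : ℝ) : Continuous (Mult μ β j t) := by
  have := mFT_cont μ
  unfold Mult
  fun_prop

lemma AD_alg (a δ γ B1 c2 τ dd jj C1 I1 A D : ℝ) (hδ : 0 < δ) (hγ : γ = δ / (1 + δ))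
    (hB10 : 0 < B1) (hc20 : 0 < c2) (hτ : 0 < τ) (hc2 : c2 = C1 * (I1 + 1))
    (hA : A = (B1 * 2 ^ (-(a * jj))) ^ 2)
    (hD : D = C1 * 2 ^ ((dd - 2*a) * jj) * (2 ^ jj * τ) ^ (-δ) * (I1 + 1)) :
    A ^ (2 - (2 - γ)) * D ^ (2 - γ - 1) =
      (B1 ^ 2) ^ γ * c2 ^ (1 - γ) * 2 ^ (jj * (dd - δ - 2*a*(δ+1)) / (δ+1)) * τ ^ (-γ) := by
  have h1γ : 1 - γ = 1 / (1 + δ) := by rw [hγ]; field_simp; ring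
  have hδγ : δ * (1 - γ) = γ := by rw [h1γ, hγ]; ring
  have h2j : (0:ℝ) < 2 ^ jj := by positivity
  have hA' : A = B1 ^ 2 * 2 ^ (-(2 * a * jj)) := by
    rw [hA, mul_pow, ← Real.rpow_natCast (2 ^ (-(a * jj))), ← Real.rpow_mul (by norm_num)]
    congr 2; push_cast; ring
  have hD' : D = c2 * 2 ^ ((dd - 2*a - δ) * jj) * τ ^ (-δ) := by
    rw [hD, hc2, Real.mul_rpow h2j.le hτ.le, ← Real.rpow_mul (by norm_num)]
    rw [show (dd - 2*a - δ) * jj = (dd - 2*a) * jj + jj * -δ by ring, Real.rpow_add (by norm_num)]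
    ring
  rw [show 2 - (2 - γ) = γ by ring, show 2 - γ - 1 = 1 - γ by ring, hA', hD',
    Real.mul_rpow (by positivity) (by positivity), Real.mul_rpow (by positivity) (by positivity),
    Real.mul_rpow (by positivity) (by positivity), ← Real.rpow_mul (by norm_num), ← Real.rpow_mul (by norm_num),
    ← Real.rpow_mul hτ.le, show -δ * (1 - γ) = -γ by rw [neg_mul, hδγ]]
  have he : jj * (dd - δ - 2*a*(δ+1)) / (δ+1) = -(2 * a * jj) * γ + (dd - 2*a - δ) * jj * (1 - γ) := by
    rw [h1γ, hγ]; field_simp; ring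
  rw [he, Real.rpow_add (by norm_num)]
  ring

lemma Mult_bound (μ : Measure (EE d)) [IsFiniteMeasure μ]
    (a C C1 Mb : ℝ) (ha : 1/2 < a) (hC10 : 0 < C1) (hCC1 : C ≤ C1) (hMb0 : 0 ≤ Mb)
    (hdecay : ∀ ξ : EE d, ξ ≠ 0 → ‖mFT μ ξ‖ ≤ C * ‖ξ‖ ^ (-a))
    (β : ℝ → ℝ) (hz : ∀ r, r ∉ Ioo (1/2 : ℝ) 2 → β r = 0) (hMb : ∀ r, |β r| ≤ Mb)
    (j : ℕ) (t : ℝ) (ht : t ∈ Icc (1:ℝ) 2) (ξ : EE d) :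
    ‖Mult μ β j t ξ‖ ≤ (Mb + 1) * (C1 * 2 ^ a) * 2 ^ (-(a * (j:ℝ))) := by
  have h2j : (0:ℝ) < 2 ^ (j:ℝ) := by positivity
  have hzp : (2:ℝ) ^ (-(j:ℤ)) = ((2:ℝ) ^ (j:ℝ))⁻¹ := by
    rw [zpow_neg, Real.rpow_natCast, zpow_natCast]
  by_cases hb : (2:ℝ) ^ (-(j:ℤ)) * ‖ξ‖ ∈ Ioo (1/2 : ℝ) 2
  · have h1 : 2 ^ (j:ℝ) / 2 < ‖ξ‖ := by
      have := hb.1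
      rw [hzp, inv_mul_eq_div, lt_div_iff₀ h2j] at this
      linarith
    have h2 : 2 ^ (j:ℝ) / 2 ≤ ‖t • ξ‖ := by
      rw [norm_smul, Real.norm_of_nonneg (by linarith [ht.1])]
      nlinarith [ht.1, norm_nonneg ξ]
    have h3 : t • ξ ≠ 0 := by
      intro h; rw [h, norm_zero] at h2
      linarith
    have h4 : ‖mFT μ (t • ξ)‖ ≤ C1 * 2 ^ a * 2 ^ (-(a * (j:ℝ))) := by
      calc _ ≤ C * ‖t • ξ‖ ^ (-a) := hdecay _ h3
        _ ≤ C1 * ‖t • ξ‖ ^ (-a) := by gcongr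
        _ ≤ C1 * (2 ^ (j:ℝ) / 2) ^ (-a) := by
            gcongr C1 * ?_
            exact Real.rpow_le_rpow_of_nonpos (by positivity) h2 (by linarith)
        _ = _ := by
            rw [Real.div_rpow h2j.le (by norm_num), ← Real.rpow_mul (by norm_num), Real.rpow_neg (by norm_num) a, div_inv_eq_mul]
            rw [show (j:ℝ) * -a = -(a * j) by ring]; ring
    unfold Mult
    rw [norm_mul, Complex.norm_real, Real.norm_eq_abs]
    calc _ ≤ (Mb + 1) * (C1 * 2 ^ a * 2 ^ (-(a * (j:ℝ)))) :=
          mul_le_mul ((hMb _).trans (by linarith)) h4 (norm_nonneg _) (by linarith)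
      _ = _ := by ring
  · unfold Mult
    rw [hz _ hb]
    simp only [Complex.ofReal_zero, zero_mul, norm_zero]
    positivity

set_option maxHeartbeats 400000 in
lemma main_bil (μ : Measure (EE d)) [IsFiniteMeasure μ]
    (a C δ : ℝ) (ha : 1/2 < a) (hδ : 0 < δ)
    (hdecay : ∀ ξ : EE d, ξ ≠ 0 → ‖mFT μ ξ‖ ≤ C * ‖ξ‖ ^ (-a))
    (β : ℝ → ℝ) (hβsm : ContDiff ℝ (⊤ : ℕ∞) β)
    (hβsupp : Function.support β ⊆ Ioo (1/2 : ℝ) 2)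
    (hdisp : ∀ j : ℕ, 1 ≤ j → ∀ t ∈ Icc (1:ℝ) 2, ∀ s ∈ Icc (1:ℝ) 2, ∀ x : EE d,
        ‖Kdisp μ β j t s x‖ ≤
          C * 2 ^ (((d:ℝ) - 2*a) * (j:ℝ)) * (1 + 2 ^ (j:ℝ) * |t - s|) ^ (-δ))
    (Mb : ℝ) (hMb : ∀ r, |β r| ≤ Mb) (γ : ℝ) (hγ : γ = δ / (1 + δ)) :
    ∃ K : ℝ, 0 < K ∧ ∀ j : ℕ, 1 ≤ j →
      ∀ t ∈ Icc (1:ℝ) 2, ∀ s ∈ Icc (1:ℝ) 2, t ≠ s → ∀ F G : EE d → ℂ, SAdm volume F → SAdm volume G →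
      ‖bil (fun ξ => (starRingEnd ℂ) (Mult μ β j t ξ) * Mult μ β j s ξ) F G‖ₑ ≤
      ENNReal.ofReal (K * 2 ^ ((j:ℝ) * ((d:ℝ) - δ - 2*a*(δ+1)) / (δ+1)) * |t - s| ^ (-γ) *
        ((∫ x, ‖F x‖ ^ (2/(2-γ))) ^ (1 - γ/2) * (∫ x, ‖G x‖ ^ (2/(2-γ))) ^ (1 - γ/2))) := by
  have hβc : Continuous β := hβsm.continuous
  have hMb0 : 0 ≤ Mb := (abs_nonneg _).trans (hMb 0)
  have hγ0 : 0 < γ := by rw [hγ]; positivity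
  have hγ1 : γ < 1 := by rw [hγ, div_lt_one (by positivity)]; linarith
  have h1γ : 1 - γ = 1 / (1 + δ) := by rw [hγ]; field_simp; ring
  have hδγ : δ * (1 - γ) = γ := by rw [h1γ, hγ]; ring
  obtain ⟨S, hS⟩ := radial_schwartz (d := d) β hβsm hβsupp
  set ψ : SchwartzMap (EE d) ℂ := 𝓕⁻ S with hψ
  have hψF : ∀ ξ, 𝓕 (ψ : EE d → ℂ) ξ = S ξ := by
    intro ξ
    rw [← SchwartzMap.fourier_coe, hψ, FourierTransform.fourier_fourierInv_eq]
  set I1 : ℝ := ∫ x, ‖ψ x‖ with hI1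
  have hI10 : 0 ≤ I1 := integral_nonneg fun _ => norm_nonneg _
  set C1 : ℝ := |C| + 1 with hC1
  have hC10 : 0 < C1 := by positivity
  have hCC1 : C ≤ C1 := by rw [hC1]; linarith [le_abs_self C]
  set B1 : ℝ := (Mb + 1) * (C1 * 2 ^ a) with hB1
  have hB10 : 0 < B1 := by positivity
  set c2 : ℝ := C1 * (I1 + 1) with hc2
  have hc20 : 0 < c2 := by positivity
  set p : ℝ := 2 / (2 - γ) with hp
  have h2γ : 0 < 2 - γ := by linarith
  have hp1 : 1 < p := by rw [hp, lt_div_iff₀ h2γ]; linarith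
  have hp2 : p < 2 := by rw [hp, div_lt_iff₀ h2γ]; linarith
  have e1p : 1 / p = 1 - γ/2 := by rw [hp]; field_simp
  have e2p : 2 / p = 2 - γ := by rw [hp]; field_simp
  set cp : ℝ := 2 ^ (2 - p) + (1 - 2 ^ (-(2 - p)))⁻¹ + 1 with hcp
  have hcp0 : 0 < cp := by
    have : (2:ℝ) ^ (-(2-p)) < 1 := Real.rpow_lt_one_of_one_lt_of_neg (by norm_num) (by linarith)
    have h2 : 0 < (1 - (2:ℝ) ^ (-(2 - p)))⁻¹ := inv_pos.2 (by linarith)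
    positivity
  refine ⟨cp * ((B1 ^ 2) ^ γ * c2 ^ (1 - γ)), by positivity, ?_⟩
  intro j hj t ht s hs hts F G hF hG
  have hts0 : 0 < |t - s| := abs_pos.2 (sub_ne_zero.2 hts)
  have h2j : (0:ℝ) < 2 ^ (j:ℝ) := by positivity
  have hzp : (2:ℝ) ^ (-(j:ℤ)) = ((2:ℝ) ^ (j:ℝ))⁻¹ := by
    rw [zpow_neg, Real.rpow_natCast, zpow_natCast]
  have hz : ∀ r, r ∉ Ioo (1/2 : ℝ) 2 → β r = 0 := by
    intro r hr
    by_contra h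
    exact hr (hβsupp h)
  have hMt : ∀ t ∈ Icc (1:ℝ) 2, ∀ ξ, ‖Mult μ β j t ξ‖ ≤ B1 * 2 ^ (-(a * (j:ℝ))) :=
    fun t ht ξ => Mult_bound μ a C C1 Mb ha hC10 hCC1 hMb0 hdecay β hz hMb j t ht ξ
  set m : EE d → ℂ := fun ξ => (starRingEnd ℂ) (Mult μ β j t ξ) * Mult μ β j s ξ with hm
  set A : ℝ := (B1 * 2 ^ (-(a * (j:ℝ)))) ^ 2 with hA
  have hA0 : 0 < A := by positivity
  have hmA : ∀ ξ, ‖m ξ‖ ≤ A := by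
    intro ξ
    have h0 : ‖m ξ‖ = ‖Mult μ β j t ξ‖ * ‖Mult μ β j s ξ‖ := by
      simp only [hm, norm_mul, RCLike.norm_conj]
    have h1 : A = (B1 * 2 ^ (-(a * (j:ℝ)))) * (B1 * 2 ^ (-(a * (j:ℝ)))) := sq _
    rw [h0, h1]
    exact mul_le_mul (hMt t ht ξ) (hMt s hs ξ) (norm_nonneg _) (by positivity)
  have hMc : ∀ t, Continuous (Mult μ β j t) := fun t =>
    Mult_cont1 μ β hβc j t
  -- the cut off measure product
  have hmF := mFT_cont μ
  set n : EE d → ℂ := fun ξ => ((β ((2:ℝ) ^ (-(j:ℤ)) * ‖ξ‖) : ℝ) : ℂ) *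
    (mFT μ (s • ξ) * (starRingEnd ℂ) (mFT μ (t • ξ))) with hn
  have hnz : ∀ ξ : EE d, ξ ∉ closedBall (0 : EE d) (2 * 2 ^ (j:ℝ)) → β ((2:ℝ) ^ (-(j:ℤ)) * ‖ξ‖) = 0 := by
    intro ξ hξ
    apply hz
    intro h
    apply hξ
    have := h.2
    rw [hzp, inv_mul_eq_div, div_lt_iff₀ h2j] at this
    simpa using this.le
  have hni : Integrable n := by
    apply Continuous.integrable_of_hasCompactSupport
    · rw [hn]; fun_prop
    · apply HasCompactSupport.intro (isCompact_closedBall (0 : EE d) (2 * 2 ^ (j:ℝ)))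
      intro ξ hξ
      simp only [hn, hnz ξ hξ, Complex.ofReal_zero, zero_mul]
  have hmi : Integrable m := by
    apply Continuous.integrable_of_hasCompactSupport
    · have h1 := hMc t
      have h2 := hMc s
      rw [hm]; fun_prop
    · apply HasCompactSupport.intro (isCompact_closedBall (0 : EE d) (2 * 2 ^ (j:ℝ)))
      intro ξ hξ
      simp only [hm, Mult, hnz ξ hξ, Complex.ofReal_zero, zero_mul, mul_zero]
  set D0 : ℝ := C1 * 2 ^ (((d:ℝ) - 2*a) * (j:ℝ)) * (2 ^ (j:ℝ) * |t - s|) ^ (-δ) with hD0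
  have hD00 : 0 < D0 := by positivity
  have hnD : ∀ z, ‖𝓕 n z‖ ≤ D0 := by
    intro z
    have e : 𝓕 n z = Kdisp μ β j s t (-z) := by
      unfold Kdisp
      rw [Real.fourier_eq]
      simp_rw [exp_eq_char]
      congr 1; ext ξ
      simp only [hn, Circle.smul_def, smul_eq_mul, inner_neg_left]
      rw [real_inner_comm ξ z]; ring
    rw [e]
    refine (hdisp j hj s hs t ht (-z)).trans ?_
    rw [hD0, abs_sub_comm s t]
    have h1 : (1 + 2 ^ (j:ℝ) * |t - s|) ^ (-δ) ≤ (2 ^ (j:ℝ) * |t - s|) ^ (-δ) :=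
      Real.rpow_le_rpow_of_nonpos (by positivity) (by linarith) (by linarith)
    have h2 : C * 2 ^ (((d:ℝ) - 2*a) * (j:ℝ)) ≤ C1 * 2 ^ (((d:ℝ) - 2*a) * (j:ℝ)) := by gcongr
    exact mul_le_mul h2 h1 (by positivity) (by positivity)
  obtain ⟨P, hPi, hPn, hPF⟩ := scale_L1 (ψ : EE d → ℂ) ψ.integrable (2 ^ (j:ℝ)) h2j
  have hmn : m = fun ξ => 𝓕 P ξ * n ξ := by
    ext ξ
    rw [hPF, hψF, hS, norm_smul, Real.norm_of_nonneg (by positivity), ← hzp]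
    simp only [hm, hn, Mult, map_mul, Complex.conj_ofReal]; ring
  set D : ℝ := D0 * (I1 + 1) with hD
  have hDpos : 0 < D := by positivity
  have hmD : ∀ z, ‖𝓕 m z‖ ≤ D := by
    intro z
    rw [hmn]
    refine (fourier_mul_bound P n hPi hni D0 hnD z).trans ?_
    rw [hPn, hD]
    gcongr; linarith
  refine (bil_interp p hp1 hp2 m hmi A D hA0 hDpos hmA hmD F G hF hG).trans (le_of_eq ?_)
  rw [e1p, e2p]
  congr 1
  have hAD := AD_alg a δ γ B1 c2 |t - s| d j C1 I1 A D hδ hγ hB10 hc20 hts0 rfl rfl rfl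
  rw [hAD]; ring

/-- Strichartz-type estimate: under the Fourier decay and dispersive assumptions,
‖(P_j f) ∗ μ_t‖_{L^{2(δ+1)/δ}(ℝ^d × I)} ≤ C' 2^{j(d−δ−2a(δ+1))/(2(δ+1))} ‖f‖_{L²}. -/
theorem stmt18 (d : ℕ) (hd : 1 ≤ d) (μ : Measure (EuclideanSpace ℝ (Fin d)))
    [IsFiniteMeasure μ] (hcomp : ∃ K : Set (EuclideanSpace ℝ (Fin d)), IsCompact K ∧ μ Kᶜ = 0)
    (a C δ : ℝ) (ha : 1/2 < a) (hδ : 0 < δ)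
    (hdecay : ∀ ξ : EuclideanSpace ℝ (Fin d), ξ ≠ 0 → ‖mFT μ ξ‖ ≤ C * ‖ξ‖ ^ (-a))
    (β : ℝ → ℝ) (hβsm : ContDiff ℝ (⊤ : ℕ∞) β)
    (hβsupp : Function.support β ⊆ Ioo (1/2 : ℝ) 2)
    (hβsum : ∀ t : ℝ, 0 < t → HasSum (fun j : ℤ => β ((2:ℝ) ^ j * t)) 1)
    (hdisp : ∀ j : ℕ, 1 ≤ j → ∀ t ∈ Icc (1:ℝ) 2, ∀ s ∈ Icc (1:ℝ) 2,
      ∀ x : EuclideanSpace ℝ (Fin d),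
        ‖Kdisp μ β j t s x‖ ≤
          C * 2 ^ (((d:ℝ) - 2*a) * (j:ℝ)) * (1 + 2 ^ (j:ℝ) * |t - s|) ^ (-δ)) :
    ∃ C' : ℝ, 0 < C' ∧ ∀ j : ℕ, 1 ≤ j → ∀ f : SchwartzMap (EuclideanSpace ℝ (Fin d)) ℂ,
      (∫⁻ x, ∫⁻ t in Icc (1:ℝ) 2,
          (‖convM (Pproj β (j : ℤ) ⇑f) μ t x‖₊ : ℝ≥0∞) ^ (2*(δ+1)/δ)) ^ (δ/(2*(δ+1))) ≤
        ENNReal.ofReal (C' * 2 ^ ((j:ℝ) * ((d:ℝ) - δ - 2*a*(δ+1)) / (2*(δ+1)))) *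
          (∫⁻ x, (‖f x‖₊ : ℝ≥0∞) ^ (2:ℝ)) ^ (1/(2:ℝ)) := by
  have hβc : Continuous β := hβsm.continuous
  obtain ⟨Mb, hMb⟩ : ∃ Mb : ℝ, ∀ r, |β r| ≤ Mb := by
    have hcs : HasCompactSupport β := by
      apply HasCompactSupport.intro (isCompact_Icc (a := (1/2:ℝ)) (b := 2))
      intro r hr
      by_contra h
      exact hr (Ioo_subset_Icc_self (hβsupp h))
    obtain ⟨Mb, h⟩ := hβc.bounded_above_of_compact_support hcs
    exact ⟨Mb, fun r => h r⟩
  have hMb0 : 0 ≤ Mb := (abs_nonneg _).trans (hMb 0)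
  set γ : ℝ := δ / (1 + δ) with hγ
  have hγ0 : 0 < γ := by rw [hγ]; positivity
  have hγ1 : γ < 1 := by rw [hγ, div_lt_one (by positivity)]; linarith
  obtain ⟨K, hK0, hK⟩ := main_bil μ a C δ ha hδ hdecay β hβsm hβsupp hdisp Mb hMb γ hγ
  set c : ℝ := 1 + 4/(1-γ) + 8/γ with hc
  have hc0 : 0 < c := by
    have : 0 < 1 - γ := by linarith
    positivity
  refine ⟨(K * c) ^ (1/2:ℝ), by positivity, ?_⟩
  intro j hj f
  have hfF : (𝓕 (f : EE d → ℂ)) = ((𝓕 f : SchwartzMap (EE d) ℂ) : EE d → ℂ) :=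
    (SchwartzMap.fourier_coe f).symm
  have hφi : Integrable (𝓕 (f : EE d → ℂ)) := by rw [hfF]; exact SchwartzMap.integrable _
  have hφc : Continuous (𝓕 (f : EE d → ℂ)) := by rw [hfF]; exact SchwartzMap.continuous _
  have hB : ∀ t (ξ : EE d), ‖Mult μ β j t ξ‖ ≤ Mb * μ.real univ := by
    intro t ξ
    unfold Mult
    rw [norm_mul, Complex.norm_real, Real.norm_eq_abs]
    exact mul_le_mul (hMb _) (mFT_bdd μ _) (norm_nonneg _) hMb0
  have hR0 : ∀ t (ξ : EE d), 2 * 2 ^ (j:ℝ) < ‖ξ‖ → Mult μ β j t ξ = 0 := by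
    intro t ξ hξ
    unfold Mult
    have : β ((2:ℝ) ^ (-(j:ℤ)) * ‖ξ‖) = 0 := by
      by_contra h
      have h2 := (hβsupp h).2
      have h2j : (0:ℝ) < 2 ^ (j:ℝ) := by positivity
      have hzp : (2:ℝ) ^ (-(j:ℤ)) = ((2:ℝ) ^ (j:ℝ))⁻¹ := by
        rw [zpow_neg, Real.rpow_natCast, zpow_natCast]
      rw [hzp, inv_mul_eq_div, div_lt_iff₀ h2j] at h2
      linarith
    rw [this]; simp
  have hmain := tt_all γ hγ0 hγ1 (Mult μ β j) (Mult_cont μ β hβc j) _ _ hB hR0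
    (𝓕 (f : EE d → ℂ)) hφc hφi (K * 2 ^ ((j:ℝ) * ((d:ℝ) - δ - 2*a*(δ+1)) / (δ+1)))
    (by positivity) (hK j hj)
  have hpl : ∫⁻ ξ, ‖𝓕 (f : EE d → ℂ) ξ‖ₑ ^ (2:ℝ) = ∫⁻ x, (‖f x‖₊ : ℝ≥0∞) ^ (2:ℝ) := by
    have h := bessel (f : EE d → ℂ) f.integrable (f.memLp 2 volume)
    have e : ∀ z : ℂ, ENNReal.ofReal (‖z‖ ^ 2) = ‖z‖ₑ ^ (2:ℝ) := by
      intro z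
      rw [ENNReal.ofReal_pow (norm_nonneg _), ofReal_norm]
      simp
    simp_rw [e] at h
    exact h
  have eq1 : 2 / γ = 2 * (δ + 1) / δ := by rw [hγ]; field_simp; ring
  have eq2 : γ / 2 = δ / (2 * (δ + 1)) := by rw [hγ]; field_simp; ring
  have eq3 : (K * 2 ^ ((j:ℝ) * ((d:ℝ) - δ - 2*a*(δ+1)) / (δ+1)) * c) ^ (1/2:ℝ) =
      (K * c) ^ (1/2:ℝ) * 2 ^ ((j:ℝ) * ((d:ℝ) - δ - 2*a*(δ+1)) / (2*(δ+1))) := by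
    rw [show K * 2 ^ ((j:ℝ) * ((d:ℝ) - δ - 2*a*(δ+1)) / (δ+1)) * c =
      (K * c) * 2 ^ ((j:ℝ) * ((d:ℝ) - δ - 2*a*(δ+1)) / (δ+1)) by ring,
      Real.mul_rpow (by positivity) (by positivity), ← Real.rpow_mul (by norm_num)]
    congr 2
    field_simp
  rw [eq1, eq2, ← hc, eq3, hpl] at hmain
  simp_rw [rep μ β hβc Mb hMb j (f : EE d → ℂ) hφi]
  exact hmain
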